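/- arXiv:2010.13599 — 2 statements merged into one kernel-verified Lean document; each statement's English description precedes it below -/
import Mathlib

section
/- Asymptotic normality of the Horvitz–Thompson estimator (Proposition 2): Fix p ∈ (0,1), b > 0, and c̃ ∈ ℕ. For each N, let Z^{(N)} be an i.i.d. Bernoulli(p) vector of length N, let μ_{i,N} : {0,1}^N → ℝ satisfy |μ_{i,N}(z)| ≤ b for all i, N, z, and let B_N be a dependency structure for (μ_{1,N},…,μ_{N,N}) with |B_N(i)| ≤ c̃ for all i, N. Define U_{i,N} = (Z_i/p − (1−Z_i)/(1−p)) μ_{i,N}(Z^{(N)}) − (E[μ_{i,N}^{(1)}(Z^{(N)})] − E[μ_{i,N}^{(0)}(Z^{(N)})]), and assume that for each i and N the random variable U_{i,N} is independent of the family {U_{j,N} : j ∉ B_N(i)}. Let τ̂_N and τ_N denote the Horvitz–Thompson estimator and the average marginalized response for the N-th problem, and suppose N·Var(τ̂_N) → V as N → ∞ with V > 0. Then √N (τ̂_N − τ_N) converges in distribution to the Gaussian law with mean 0 and variance V, i.e. the laws of √N (τ̂_N − τ_N) converge weakly to N(0, V). -/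
open MeasureTheory ProbabilityTheory Filter Topology

/-- The Bernoulli(p) measure on `Bool`. -/
noncomputable def bern (p : ℝ) : Measure Bool :=
  ENNReal.ofReal p • Measure.dirac true + ENNReal.ofReal (1 - p) • Measure.dirac false

/-- The i.i.d. Bernoulli(p) product measure on `{0,1}^N`. -/
noncomputable def bernPi (N : ℕ) (p : ℝ) : Measure (Fin N → Bool) :=
  Measure.pi fun _ => bern p

/-- Horvitz–Thompson estimator for the N-th problem. -/
noncomputable def tauHatHT (N : ℕ) (p : ℝ) (μ : Fin N → (Fin N → Bool) → ℝ)
    (z : Fin N → Bool) : ℝ :=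
  (1 / (N * p)) * ∑ i, (if z i then (1 : ℝ) else 0) * μ i z
    - (1 / (N * (1 - p))) * ∑ i, (1 - if z i then (1 : ℝ) else 0) * μ i z

/-- Average marginalized response for the N-th problem. -/
noncomputable def amr (N : ℕ) (p : ℝ) (μ : Fin N → (Fin N → Bool) → ℝ) : ℝ :=
  (1 / N) * ∑ i, ((∫ z, μ i (Function.update z i true) ∂ bernPi N p)
    - ∫ z, μ i (Function.update z i false) ∂ bernPi N p)

/-- The centered Horvitz–Thompson summand
`U_i = (Z_i/p − (1−Z_i)/(1−p)) μ_i(Z) − (E[μ_i^{(1)}(Z)] − E[μ_i^{(0)}(Z)])`. -/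
noncomputable def Ufun (N : ℕ) (p : ℝ) (μ : Fin N → (Fin N → Bool) → ℝ) (i : Fin N)
    (z : Fin N → Bool) : ℝ :=
  ((if z i then (1 : ℝ) else 0) / p - (1 - if z i then (1 : ℝ) else 0) / (1 - p)) * μ i z
    - ((∫ w, μ i (Function.update w i true) ∂ bernPi N p)
        - ∫ w, μ i (Function.update w i false) ∂ bernPi N p)


section Independence

variable {κ α : Type*} [Fintype κ] [MeasurableSpace α]
  [Finite α] [DiscreteMeasurableSpace α]

/-- Functions of disjoint blocks of coordinates are uncorrelated under a product measure. -/
lemma integral_mul_of_dependsOn_disjoint {ν : κ → Measure α} [∀ k, IsProbabilityMeasure (ν k)]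
    {f g : (κ → α) → ℂ} {s t : Finset κ} (hf : DependsOn f s) (hg : DependsOn g t)
    (hst : Disjoint s t) :
    ∫ z, f z * g z ∂Measure.pi ν = (∫ z, f z ∂Measure.pi ν) * ∫ z, g z ∂Measure.pi ν := by
  have hind : iIndepFun (fun (k : κ) (z : κ → α) ↦ z k) (Measure.pi ν) :=
    iIndepFun_pi (X := fun _ ↦ id) fun _ ↦ aemeasurable_id
  have hblock := hind.indepFun_finset s t hst fun k ↦ measurable_pi_apply k
  obtain ⟨f', rfl⟩ := dependsOn_iff_exists_comp.1 hf
  obtain ⟨g', rfl⟩ := dependsOn_iff_exists_comp.1 hg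
  have h : IndepFun (f' ∘ (s : Set κ).domRestrict) (g' ∘ (t : Set κ).domRestrict) (Measure.pi ν) :=
    hblock.comp (Measurable.of_discrete (f := f')) (Measurable.of_discrete (f := g'))
  exact h.integral_fun_mul_eq_mul_integral
    (Measurable.of_discrete).aestronglyMeasurable (Measurable.of_discrete).aestronglyMeasurable

lemma integral_mul_of_dependsOn_disjoint_real {ν : κ → Measure α}
    [∀ k, IsProbabilityMeasure (ν k)]
    {f g : (κ → α) → ℝ} {s t : Finset κ} (hf : DependsOn f s) (hg : DependsOn g t)
    (hst : Disjoint s t) :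
    ∫ z, f z * g z ∂Measure.pi ν = (∫ z, f z ∂Measure.pi ν) * ∫ z, g z ∂Measure.pi ν := by
  have h := integral_mul_of_dependsOn_disjoint (ν := ν)
    (f := fun z ↦ (f z : ℂ)) (g := fun z ↦ (g z : ℂ))
    (fun x y h ↦ by simp [hf h]) (fun x y h ↦ by simp [hg h]) hst
  simp_rw [← Complex.ofReal_mul, integral_complex_ofReal] at h
  exact_mod_cast h

end Independence

lemma norm_exp_I_mul_sub_one_sub_le (x : ℝ) :
    ‖Complex.exp (Complex.I * x) - 1 - Complex.I * x‖ ≤ 3 * x ^ 2 := by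
  rcases le_total |x| 1 with hx | hx
  · have h := Complex.norm_exp_sub_one_sub_id_le (x := Complex.I * x) (by simpa using hx)
    simp only [norm_mul, Complex.norm_I, Complex.norm_real, one_mul, Real.norm_eq_abs,
      sq_abs] at h
    nlinarith [sq_nonneg x]
  · have h1 := Real.norm_exp_I_mul_ofReal_sub_one_le (x := x)
    have h2 := norm_sub_le (Complex.exp (Complex.I * x) - 1) (Complex.I * x)
    simp only [norm_mul, Complex.norm_I, Complex.norm_real, one_mul, Real.norm_eq_abs] at h1 h2
    nlinarith [sq_abs x]

section LocalDependence

variable {ι κ α : Type*} [Fintype ι]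

open Classical in
/-- The indices whose coordinate block meets `s`. -/
noncomputable def meeting (A : ι → Finset κ) (s : Finset κ) : Finset ι :=
  Finset.univ.filter fun j ↦ ¬ Disjoint s (A j)

lemma dependsOn_sum_sub_meeting {A : ι → Finset κ} {X : ι → (κ → α) → ℝ} [DecidableEq κ]
    [Fintype κ] (hX : ∀ i, DependsOn (X i) (A i)) (s : Finset κ) :
    DependsOn (fun z ↦ ∑ j, X j z - ∑ j ∈ meeting A s, X j z) ((sᶜ : Finset κ) : Set κ) := by
  classical
  intro x y h
  have key : ∀ z, ∑ j, X j z - ∑ j ∈ meeting A s, X j z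
      = ∑ j ∈ Finset.univ \ meeting A s, X j z := fun z ↦ by
    rw [← Finset.sum_sdiff (Finset.subset_univ (meeting A s))]; ring
  simp only [key]
  refine Finset.sum_congr rfl fun j hj ↦ hX j fun k hk ↦ h k ?_
  simp only [meeting, Finset.mem_sdiff, Finset.mem_univ, Finset.mem_filter, true_and,
    not_not] at hj
  simpa using fun hks ↦ Finset.disjoint_left.1 hj hks hk

lemma abs_sum_meeting_le {A : ι → Finset κ} {X : ι → (κ → α) → ℝ} {δ : ℝ}
    (hδ : ∀ i z, |X i z| ≤ δ) (hδ0 : 0 ≤ δ) {s : Finset κ} {e : ℕ} (he : (meeting A s).card ≤ e)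
    (z : κ → α) : |∑ j ∈ meeting A s, X j z| ≤ e * δ :=
  calc |∑ j ∈ meeting A s, X j z| ≤ ∑ j ∈ meeting A s, |X j z| := Finset.abs_sum_le_sum_abs _ _
    _ ≤ (meeting A s).card • δ := Finset.sum_le_card_nsmul _ _ _ fun j _ ↦ hδ j z
    _ ≤ e * δ := by rw [nsmul_eq_mul]; gcongr

lemma card_meeting_biUnion_le {A : ι → Finset κ} [DecidableEq κ] {d : ℕ}
    (hd : ∀ i, (meeting A (A i)).card ≤ d) (F : Finset ι) :
    (meeting A (F.biUnion A)).card ≤ F.card * d := by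
  classical
  refine (Finset.card_le_card ?_).trans
    (Finset.card_biUnion_le_card_mul F (fun j ↦ meeting A (A j)) d fun j _ ↦ hd j)
  intro k hk
  simpa [meeting, Finset.disjoint_biUnion_left] using hk

variable [Fintype κ] [Finite α] [MeasurableSpace α] [DiscreteMeasurableSpace α]
  {ν : κ → Measure α} [∀ k, IsProbabilityMeasure (ν k)]

local notation "𝐞" x:max => Complex.exp (Complex.I * (x : ℝ))

lemma norm_integral_mul_exp_sub_le {A : ι → Finset κ} {X : ι → (κ → α) → ℝ} {δ M : ℝ}
    (hX : ∀ i, DependsOn (X i) (A i)) (hδ : ∀ i z, |X i z| ≤ δ) (hδ0 : 0 ≤ δ)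
    {W : (κ → α) → ℝ} {s : Finset κ} (hW : DependsOn W s) (hM : ∀ z, |W z| ≤ M)
    {e : ℕ} (he : (meeting A s).card ≤ e) (t : ℝ) :
    ‖∫ z, (W z : ℂ) * 𝐞 (t * ∑ i, X i z) ∂Measure.pi ν
      - (∫ z, W z ∂Measure.pi ν : ℝ)
        * ∫ z, 𝐞 (t * ∑ i, X i z) ∂Measure.pi ν‖
      ≤ 2 * M * (|t| * (e * δ)) := by
  classical
  set P := Measure.pi ν
  set S : (κ → α) → ℝ := fun z ↦ ∑ i, X i z with hS
  set R : (κ → α) → ℝ := fun z ↦ ∑ i ∈ meeting A s, X i z with hR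
  have hdep : DependsOn (fun z ↦ 𝐞 (t * (S z - R z))) ((sᶜ : Finset κ) : Set κ) :=
    fun x y h ↦ by
      have := dependsOn_sum_sub_meeting hX s h
      simp only [hS, hR, this]
  have hind : ∫ z, (W z : ℂ) * 𝐞 (t * (S z - R z)) ∂P
      = (∫ z, W z ∂P : ℝ) * ∫ z, 𝐞 (t * (S z - R z)) ∂P := by
    rw [← integral_complex_ofReal]
    exact integral_mul_of_dependsOn_disjoint (fun x y h ↦ by simp [hW h]) hdep
      disjoint_compl_right
  have hdiff : ∀ z, ‖𝐞 (t * S z) - 𝐞 (t * (S z - R z))‖ ≤ |t| * (e * δ) := fun z ↦ by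
    have : 𝐞 (t * S z) - 𝐞 (t * (S z - R z))
        = 𝐞 (t * (S z - R z)) * (𝐞 (t * R z) - 1) := by
      simp only [mul_sub, ← Complex.exp_add]
      push_cast
      ring_nf
    rw [this, norm_mul, mul_comm Complex.I, Complex.norm_exp_ofReal_mul_I, one_mul]
    refine Real.norm_exp_I_mul_ofReal_sub_one_le.trans ?_
    rw [Real.norm_eq_abs, abs_mul]
    gcongr
    exact abs_sum_meeting_le hδ hδ0 he z
  have hM0 : ∀ z, ‖(W z : ℂ)‖ ≤ M := fun z ↦ by simpa using hM z
  have hWint : |∫ z, W z ∂P| ≤ M := by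
    simpa using norm_integral_le_of_norm_le_const (μ := P) (f := W) (Eventually.of_forall hM)
  have hsplit : ∫ z, (W z : ℂ) * 𝐞 (t * S z) ∂P - (∫ z, W z ∂P : ℝ) * ∫ z, 𝐞 (t * S z) ∂P
      = ∫ z, (W z : ℂ) * (𝐞 (t * S z) - 𝐞 (t * (S z - R z))) ∂P
        - (∫ z, W z ∂P : ℝ) * ∫ z, (𝐞 (t * S z) - 𝐞 (t * (S z - R z))) ∂P := by
    simp only [mul_sub (W _ : ℂ)]
    rw [integral_sub .of_finite .of_finite, integral_sub .of_finite .of_finite, hind]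
    ring
  have h1 : ‖∫ z, (W z : ℂ) * (𝐞 (t * S z) - 𝐞 (t * (S z - R z))) ∂P‖ ≤ M * (|t| * (e * δ)) := by
    refine (norm_integral_le_of_norm_le_const (Eventually.of_forall fun z ↦ ?_)).trans_eq
      (by simp : M * (|t| * (e * δ)) * P.real Set.univ = _)
    rw [norm_mul]
    exact mul_le_mul (hM0 z) (hdiff z) (norm_nonneg _) ((norm_nonneg _).trans (hM0 z))
  have h2 : ‖∫ z, (𝐞 (t * S z) - 𝐞 (t * (S z - R z))) ∂P‖ ≤ |t| * (e * δ) :=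
    (norm_integral_le_of_norm_le_const (Eventually.of_forall hdiff)).trans_eq (by simp)
  refine (congrArg norm hsplit).trans_le ((norm_sub_le _ _).trans ?_)
  rw [norm_mul _ (∫ z, (𝐞 (t * S z) - 𝐞 (t * (S z - R z))) ∂P), Complex.norm_real, Real.norm_eq_abs]
  have := mul_le_mul hWint h2 (norm_nonneg _) ((abs_nonneg _).trans hWint)
  linarith


lemma integral_mul_sum_meeting {A : ι → Finset κ} {X : ι → (κ → α) → ℝ}
    (hX : ∀ i, DependsOn (X i) (A i)) (i : ι) (hmean : ∫ z, X i z ∂Measure.pi ν = 0) :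
    ∫ z, X i z * ∑ j ∈ meeting A (A i), X j z ∂Measure.pi ν
      = ∫ z, X i z * ∑ j, X j z ∂Measure.pi ν := by
  classical
  have h := integral_mul_of_dependsOn_disjoint_real (ν := ν) (hX i)
    (dependsOn_sum_sub_meeting hX (A i)) disjoint_compl_right
  rw [hmean, zero_mul] at h
  simp only [mul_sub] at h
  rw [integral_sub .of_finite .of_finite] at h
  linarith

lemma norm_integral_summand_mul_exp_le {A : ι → Finset κ} {X : ι → (κ → α) → ℝ} {δ : ℝ}
    (hX : ∀ i, DependsOn (X i) (A i)) (hδ : ∀ i z, |X i z| ≤ δ) (hδ0 : 0 ≤ δ) {d : ℕ}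
    (hd : ∀ i, (meeting A (A i)).card ≤ d) (i : ι) (hmean : ∫ z, X i z ∂Measure.pi ν = 0)
    (t : ℝ) :
    ‖∫ z, Complex.I * X i z * 𝐞 (t * ∑ j, X j z) ∂Measure.pi ν
      + t * (∫ z, X i z * ∑ j, X j z ∂Measure.pi ν : ℝ) * ∫ z, 𝐞 (t * ∑ j, X j z) ∂Measure.pi ν‖
      ≤ (3 * d ^ 2 + 2 * d * ((d + 1) * d)) * δ ^ 3 * t ^ 2 := by
  classical
  rw [← integral_mul_sum_meeting hX i hmean]
  set P := Measure.pi ν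
  set S : (κ → α) → ℝ := fun z ↦ ∑ i, X i z with hS
  set R : (κ → α) → ℝ := fun z ↦ ∑ j ∈ meeting A (A i), X j z with hR
  have hRle : ∀ z, |R z| ≤ d * δ := fun z ↦ abs_sum_meeting_le hδ hδ0 (hd i) z
  have hzero : ∫ z, (X i z : ℂ) * 𝐞 (t * (S z - R z)) ∂P = 0 := by
    have hdep : DependsOn (fun z ↦ 𝐞 (t * (S z - R z))) (((A i)ᶜ : Finset κ) : Set κ) :=
      fun x y h ↦ by
        have := dependsOn_sum_sub_meeting hX (A i) h
        simp only [hS, hR, this]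
    rw [integral_mul_of_dependsOn_disjoint (f := fun z ↦ (X i z : ℂ))
      (fun x y h ↦ by simp [hX i h]) hdep disjoint_compl_right, integral_complex_ofReal, hmean]
    simp
  have hpt : ∀ z, Complex.I * X i z * 𝐞 (t * S z)
      = Complex.I * (X i z * 𝐞 (t * (S z - R z)))
        + (-(t * ((X i z * R z : ℝ) * 𝐞 (t * S z)))
          - Complex.I * X i z * 𝐞 (t * S z)
            * (𝐞 (-(t * R z)) - 1 - Complex.I * (-(t * R z) : ℝ))) := fun z ↦ by
    have : 𝐞 (t * (S z - R z)) = 𝐞 (t * S z) * 𝐞 (-(t * R z)) := by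
      rw [← Complex.exp_add]
      push_cast
      ring_nf
    rw [this]
    push_cast
    linear_combination (t * X i z * R z * Complex.exp (Complex.I * (t * S z))) * Complex.I_sq
  have hrem : ‖∫ z, Complex.I * X i z * 𝐞 (t * S z)
      * (𝐞 (-(t * R z)) - 1 - Complex.I * (-(t * R z) : ℝ)) ∂P‖
      ≤ δ * (3 * (|t| * (d * δ)) ^ 2) := by
    refine (norm_integral_le_of_norm_le_const (Eventually.of_forall fun z ↦ ?_)).trans_eq
      (by simp : δ * (3 * (|t| * (d * δ)) ^ 2) * P.real Set.univ = _)
    rw [norm_mul, norm_mul, mul_comm Complex.I ((t * S z : ℝ) : ℂ), Complex.norm_exp_ofReal_mul_I,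
      mul_one, norm_mul, Complex.norm_I, one_mul, Complex.norm_real, Real.norm_eq_abs]
    refine mul_le_mul (hδ i z) ((norm_exp_I_mul_sub_one_sub_le _).trans ?_) (norm_nonneg _) hδ0
    rw [← sq_abs (-(t * R z)), abs_neg, abs_mul]
    gcongr
    exact hRle z
  set T : Finset κ := (insert i (meeting A (A i))).biUnion A
  have hsub : ∀ j ∈ insert i (meeting A (A i)), (A j : Set κ) ⊆ T := fun j hj ↦
    Finset.coe_subset.2 (Finset.subset_biUnion_of_mem A hj)
  have hTcard : (meeting A T).card ≤ (d + 1) * d :=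
    (card_meeting_biUnion_le hd _).trans <| by
      gcongr
      exact (Finset.card_insert_le _ _).trans (by gcongr; exact hd i)
  have hWdep : DependsOn (fun z ↦ X i z * R z) T := fun x y h ↦ by
    have hi := hX i fun k hk ↦ h k (hsub i (Finset.mem_insert_self _ _) hk)
    have hsum : R x = R y := Finset.sum_congr rfl fun j hj ↦
      hX j fun k hk ↦ h k (hsub j (Finset.mem_insert_of_mem hj) hk)
    simp only [hi, hsum]
  have hW : ∀ z, |X i z * R z| ≤ δ * (d * δ) := fun z ↦ by
    rw [abs_mul]
    exact mul_le_mul (hδ i z) (hRle z) (abs_nonneg _) hδ0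
  have hcov := norm_integral_mul_exp_sub_le (ν := ν) hX hδ hδ0 hWdep hW hTcard t
  have heq : ∫ z, Complex.I * X i z * 𝐞 (t * S z) ∂P
        + t * (∫ z, X i z * R z ∂P : ℝ) * ∫ z, 𝐞 (t * S z) ∂P
      = -(∫ z, Complex.I * X i z * 𝐞 (t * S z)
          * (𝐞 (-(t * R z)) - 1 - Complex.I * (-(t * R z) : ℝ)) ∂P)
        - t * (∫ z, (X i z * R z : ℝ) * 𝐞 (t * S z) ∂P
          - (∫ z, X i z * R z ∂P : ℝ) * ∫ z, 𝐞 (t * S z) ∂P) := by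
    rw [integral_congr_ae (Eventually.of_forall hpt), integral_add .of_finite .of_finite,
      integral_sub .of_finite .of_finite, integral_neg, integral_const_mul, integral_const_mul,
      hzero]
    ring
  refine (congrArg norm heq).trans_le ((norm_sub_le _ _).trans ?_)
  rw [norm_neg, norm_mul (t : ℂ), Complex.norm_real, Real.norm_eq_abs]
  refine (add_le_add hrem (mul_le_mul_of_nonneg_left hcov (abs_nonneg t))).trans_eq ?_
  push_cast
  linear_combination (3 * d ^ 2 + 2 * d * ((d + 1) * d)) * δ ^ 3 * sq_abs t

/-- Quantitative central limit theorem for sums of centered, bounded functions of independent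
coordinates, each of which shares coordinates with at most `d` others. -/
theorem norm_integral_exp_sum_sub_gaussian_le {A : ι → Finset κ} {X : ι → (κ → α) → ℝ} {δ : ℝ}
    (hX : ∀ i, DependsOn (X i) (A i)) (hδ : ∀ i z, |X i z| ≤ δ) (hδ0 : 0 ≤ δ) {d : ℕ}
    (hd : ∀ i, (meeting A (A i)).card ≤ d) (hmean : ∀ i, ∫ z, X i z ∂Measure.pi ν = 0)
    (t : ℝ) :
    ‖∫ z, 𝐞 (t * ∑ j, X j z) ∂Measure.pi ν
        - Real.exp (-((∫ z, (∑ j, X j z) ^ 2 ∂Measure.pi ν) * t ^ 2 / 2))‖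
      ≤ Fintype.card ι * ((3 * d ^ 2 + 2 * d * ((d + 1) * d)) * δ ^ 3 * t ^ 2) * |t| := by
  classical
  have := Fintype.ofFinite α
  set P := Measure.pi ν
  set S : (κ → α) → ℝ := fun z ↦ ∑ i, X i z with hS
  set v : ℝ := ∫ z, S z ^ 2 ∂P with hv
  set C : ℝ := (3 * d ^ 2 + 2 * d * ((d + 1) * d)) * δ ^ 3
  have hC0 : 0 ≤ C := by positivity
  set φ : ℝ → ℂ := fun s ↦ ∫ z, 𝐞 (s * S z) ∂P with hφ
  have hv0 : 0 ≤ v := integral_nonneg fun z ↦ sq_nonneg _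
  have hderiv : ∀ s, HasDerivAt φ (∫ z, Complex.I * S z * 𝐞 (s * S z) ∂P) s := fun s ↦ by
    simp only [hφ, integral_fintype (μ := P) .of_finite]
    refine HasDerivAt.fun_sum fun z _ ↦ HasDerivAt.const_smul _ ?_
    have h1 : HasDerivAt (fun u : ℝ ↦ Complex.I * ((u * S z : ℝ) : ℂ)) (Complex.I * S z) s := by
      simpa using (((hasDerivAt_id s).mul_const (S z)).ofReal_comp).const_mul Complex.I
    simpa [mul_comm] using h1.cexp
  have hode : ∀ s, ‖∫ z, Complex.I * S z * 𝐞 (s * S z) ∂P + s * v * φ s‖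
      ≤ Fintype.card ι * (C * s ^ 2) := fun s ↦ by
    have h1 : ∫ z, Complex.I * S z * 𝐞 (s * S z) ∂P
        = ∑ i, ∫ z, Complex.I * X i z * 𝐞 (s * S z) ∂P := by
      rw [← integral_finsetSum _ fun _ _ ↦ .of_finite]
      refine integral_congr_ae (Eventually.of_forall fun z ↦ ?_)
      simp only [hS, Complex.ofReal_sum, Finset.mul_sum, Finset.sum_mul]
    have h2 : v = ∑ i, ∫ z, X i z * S z ∂P := by
      rw [← integral_finsetSum _ fun _ _ ↦ .of_finite]
      simp only [hv, hS, sq, Finset.sum_mul]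
    rw [h1, h2, Complex.ofReal_sum, Finset.mul_sum, Finset.sum_mul, ← Finset.sum_add_distrib]
    refine (norm_sum_le _ _).trans ?_
    rw [← nsmul_eq_mul, ← Finset.card_univ]
    exact Finset.sum_le_card_nsmul _ _ _ fun i _ ↦
      norm_integral_summand_mul_exp_le hX hδ hδ0 hd i (hmean i) s
  set ψ : ℝ → ℂ := fun s ↦ Real.exp (v * s ^ 2 / 2) * φ s with hψ
  have hψ' : ∀ s, HasDerivAt ψ (Real.exp (v * s ^ 2 / 2)
      * (∫ z, Complex.I * S z * 𝐞 (s * S z) ∂P + s * v * φ s)) s := fun s ↦ by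
    have h1 : HasDerivAt (fun u : ℝ ↦ Real.exp (v * u ^ 2 / 2))
        (Real.exp (v * s ^ 2 / 2) * (v * s)) s := by
      convert! ((((hasDerivAt_id s).pow 2).const_mul v).div_const 2).exp using 1
      simp
      ring
    convert! h1.ofReal_comp.mul (hderiv s) using 1
    push_cast
    ring
  have hmv : ‖ψ t - ψ 0‖ ≤ Real.exp (v * t ^ 2 / 2) * (Fintype.card ι * (C * t ^ 2)) * ‖t - 0‖ := by
    refine (convex_Icc (-|t|) |t|).norm_image_sub_le_of_norm_hasDerivWithin_le
      (fun s _ ↦ (hψ' s).hasDerivWithinAt) (fun s hs ↦ ?_) (by simp)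
      ⟨neg_abs_le t, le_abs_self t⟩
    have hst : s ^ 2 ≤ t ^ 2 := sq_le_sq.2 (abs_le.2 hs)
    rw [norm_mul, Complex.norm_real, Real.norm_of_nonneg (Real.exp_nonneg _)]
    refine mul_le_mul (Real.exp_le_exp.2 (by gcongr)) ((hode s).trans (by gcongr))
      (norm_nonneg _) (Real.exp_nonneg _)
  have hψ0 : ψ 0 = 1 := by simp [hψ, hφ]
  have hfac : φ t - Real.exp (-(v * t ^ 2 / 2))
      = Real.exp (-(v * t ^ 2 / 2)) * (ψ t - ψ 0) := by
    have : (Real.exp (-(v * t ^ 2 / 2)) : ℂ) * Real.exp (v * t ^ 2 / 2) = 1 := by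
      rw [← Complex.ofReal_mul, ← Real.exp_add]
      simp
    rw [hψ0, mul_sub, mul_one]
    simp only [hψ]
    rw [← mul_assoc, this, one_mul]
  refine (congrArg norm hfac).trans_le ?_
  rw [norm_mul, Complex.norm_real, Real.norm_of_nonneg (Real.exp_nonneg _)]
  refine (mul_le_mul_of_nonneg_left hmv (Real.exp_nonneg _)).trans_eq ?_
  rw [sub_zero, Real.norm_eq_abs, ← mul_assoc, ← mul_assoc, ← Real.exp_add]
  simp

end LocalDependence

lemma dependsOn_of_forall_update_eq {κ β : Type*} [Finite κ] [DecidableEq κ]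
    {f : (κ → Bool) → β} {s : Set κ}
    (h : ∀ k ∉ s, ∀ z, f (Function.update z k false) = f (Function.update z k true)) :
    DependsOn f s := by
  have := Fintype.ofFinite κ
  have hupd : ∀ k ∉ s, ∀ z a, f (Function.update z k a) = f z := fun k hk z a ↦ by
    have hz : f (Function.update z k (z k)) = f z := by rw [Function.update_eq_self]
    rw [← hz]
    cases a <;> cases z k <;> simp [h k hk z]
  intro x y hxy
  suffices ∀ F : Finset κ, f (F.piecewise x y) = f y by simpa using this Finset.univ
  intro F
  induction F using Finset.induction_on with
  | empty => simp
  | insert k F _ ih =>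
    rw [Finset.piecewise_insert]
    by_cases hk : k ∈ s
    · rw [← ih, hxy k hk]
      congr 1
      ext j
      by_cases hj : j = k
      · subst hj
        by_cases hF : j ∈ F <;> simp [hF, hxy j hk]
      · simp [hj]
    · rw [hupd k hk, ih]

lemma isProbabilityMeasure_bern {p : ℝ} (hp0 : 0 < p) (hp1 : p < 1) :
    IsProbabilityMeasure (bern p) := by
  constructor
  rw [bern]
  simp only [Measure.coe_add, Measure.coe_smul, Pi.add_apply, Pi.smul_apply, measure_univ,
    smul_eq_mul, mul_one]
  rw [← ENNReal.ofReal_add hp0.le (by linarith)]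
  simp

lemma integral_bern {p : ℝ} (hp0 : 0 < p) (hp1 : p < 1) (g : Bool → ℝ) :
    ∫ x, g x ∂bern p = p * g true + (1 - p) * g false := by
  rw [bern, integral_add_measure (Integrable.of_finite.smul_measure ENNReal.ofReal_ne_top)
      (Integrable.of_finite.smul_measure ENNReal.ofReal_ne_top), integral_smul_measure,
    integral_smul_measure, integral_dirac, integral_dirac,
    ENNReal.toReal_ofReal hp0.le, ENNReal.toReal_ofReal (by linarith), smul_eq_mul, smul_eq_mul]

section HorvitzThompson

variable {N : ℕ} {p : ℝ} {μ : Fin N → (Fin N → Bool) → ℝ}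

lemma integral_coordinate_mul_update (hp0 : 0 < p) (hp1 : p < 1) (i : Fin N) (a : Bool)
    (g : Bool → ℝ) (m : (Fin N → Bool) → ℝ) :
    ∫ z, g (z i) * m (Function.update z i a) ∂bernPi N p
      = (p * g true + (1 - p) * g false) * ∫ z, m (Function.update z i a) ∂bernPi N p := by
  have := isProbabilityMeasure_bern hp0 hp1
  have hg : DependsOn (fun z : Fin N → Bool ↦ g (z i)) (({i} : Finset (Fin N)) : Set (Fin N)) :=
    fun x y h ↦ by simp [h i (by simp)]
  have hm : DependsOn (fun z : Fin N → Bool ↦ m (Function.update z i a))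
      ((({i} : Finset (Fin N))ᶜ : Finset (Fin N)) : Set (Fin N)) := fun x y h ↦ by
    refine congrArg m (funext fun j ↦ ?_)
    by_cases hj : j = i
    · subst hj; simp
    · simpa [hj] using h j (by simpa using hj)
  rw [bernPi, integral_mul_of_dependsOn_disjoint_real hg hm disjoint_compl_right,
    ← integral_bern hp0 hp1,
    integral_comp_eval (μ := fun _ : Fin N ↦ bern p) (f := g)
      Measurable.of_discrete.aestronglyMeasurable]

lemma integral_Ufun (hp0 : 0 < p) (hp1 : p < 1) (i : Fin N) :
    ∫ z, Ufun N p μ i z ∂bernPi N p = 0 := by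
  have := isProbabilityMeasure_bern hp0 hp1
  have : IsProbabilityMeasure (bernPi N p) := by unfold bernPi; infer_instance
  have hpt : ∀ z : Fin N → Bool,
      ((if z i then (1 : ℝ) else 0) / p - (1 - if z i then (1 : ℝ) else 0) / (1 - p)) * μ i z
      = (if z i then (1 : ℝ) else 0) / p * μ i (Function.update z i true)
        - (1 - if z i then (1 : ℝ) else 0) / (1 - p) * μ i (Function.update z i false) :=
    fun z ↦ by
      have hz := Function.update_eq_self i z
      cases h : z i <;> rw [h] at hz <;> simp [hz]
  have h1 := integral_coordinate_mul_update hp0 hp1 i true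
    (fun x ↦ (if x then (1 : ℝ) else 0) / p) (μ i)
  have h0 := integral_coordinate_mul_update hp0 hp1 i false
    (fun x ↦ (1 - if x then (1 : ℝ) else 0) / (1 - p)) (μ i)
  unfold Ufun
  simp_rw [hpt]
  rw [integral_sub .of_finite .of_finite, integral_sub .of_finite .of_finite, h1, h0]
  have hp : p ≠ 0 := hp0.ne'
  have hq : 1 - p ≠ 0 := by linarith
  simp [hp, hq]

lemma abs_Ufun_le (hp0 : 0 < p) (hp1 : p < 1) {b : ℝ} (hbound : ∀ i z, |μ i z| ≤ b)
    (i : Fin N) (z : Fin N → Bool) :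
    |Ufun N p μ i z| ≤ (1 / p + 1 / (1 - p) + 2) * b := by
  have := isProbabilityMeasure_bern hp0 hp1
  have : IsProbabilityMeasure (bernPi N p) := by unfold bernPi; infer_instance
  have hresp : ∀ a, |∫ w, μ i (Function.update w i a) ∂bernPi N p| ≤ b := fun a ↦ by
    simpa using norm_integral_le_of_norm_le_const (μ := bernPi N p)
      (f := fun w ↦ μ i (Function.update w i a)) (Eventually.of_forall fun w ↦ hbound i _)
  have hp' : 0 < 1 / p := by positivity
  have hq' : 0 < 1 / (1 - p) := one_div_pos.2 (by linarith)
  have hweight : |(if z i then (1 : ℝ) else 0) / p - (1 - if z i then (1 : ℝ) else 0) / (1 - p)|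
      ≤ 1 / p + 1 / (1 - p) := by
    rw [abs_le]
    split_ifs <;> constructor <;> simp only [sub_self, sub_zero, zero_div] <;> linarith
  have h1 := abs_sub (((if z i then (1 : ℝ) else 0) / p
    - (1 - if z i then (1 : ℝ) else 0) / (1 - p)) * μ i z)
    ((∫ w, μ i (Function.update w i true) ∂bernPi N p)
      - ∫ w, μ i (Function.update w i false) ∂bernPi N p)
  have h2 := abs_sub (∫ w, μ i (Function.update w i true) ∂bernPi N p)
    (∫ w, μ i (Function.update w i false) ∂bernPi N p)
  have h3 := mul_le_mul hweight (hbound i z) (abs_nonneg _) (by linarith)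
  rw [← abs_mul] at h3
  unfold Ufun
  linarith [hresp true, hresp false]

lemma sqrt_mul_tauHatHT_sub_amr (z : Fin N → Bool) :
    Real.sqrt N * (tauHatHT N p μ z - amr N p μ) = ∑ i, (Real.sqrt N)⁻¹ * Ufun N p μ i z := by
  have h : tauHatHT N p μ z - amr N p μ = (N : ℝ)⁻¹ * ∑ i, Ufun N p μ i z := by
    simp only [tauHatHT, amr, Ufun, Finset.mul_sum, ← Finset.sum_sub_distrib]
    refine Finset.sum_congr rfl fun i _ ↦ ?_
    rw [one_div, one_div, one_div, mul_inv, mul_inv]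
    ring
  rw [h, ← Finset.mul_sum, ← mul_assoc, ← div_eq_mul_inv, Real.sqrt_div_self]

end HorvitzThompson

/-- The indices `k` linked to `i` in both directions. -/
def mutualNeighbors {ι : Type*} [DecidableEq ι] (B : ι → Finset ι) (i : ι) : Finset ι :=
  (B i).filter fun k ↦ i ∈ B k

lemma card_meeting_mutualNeighbors_le {ι : Type*} [DecidableEq ι] [Fintype ι]
    {B : ι → Finset ι} {c : ℕ} (hc : ∀ i, (B i).card ≤ c) (i : ι) :
    (meeting (mutualNeighbors B) (mutualNeighbors B i)).card ≤ c * c := by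
  have hle : ∀ i, (mutualNeighbors B i).card ≤ c := fun i ↦
    (Finset.card_filter_le _ _).trans (hc i)
  refine (Finset.card_le_card (t := (mutualNeighbors B i).biUnion (mutualNeighbors B)) ?_).trans
    ((Finset.card_biUnion_le_card_mul _ _ c fun j _ ↦ hle j).trans
      (Nat.mul_le_mul_right c (hle i)))
  intro k hk
  simp only [meeting, Finset.mem_filter, Finset.mem_univ, true_and, Finset.not_disjoint_iff] at hk
  obtain ⟨m, hmi, hmk⟩ := hk
  refine Finset.mem_biUnion.2 ⟨m, hmi, ?_⟩
  simpa [mutualNeighbors, and_comm] using hmk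

/-- Asymptotic normality of the Horvitz–Thompson estimator (Proposition 2):
if `N·Var(τ̂_N) → V > 0`, then `√N (τ̂_N − τ_N)` converges in distribution to `N(0, V)`
(weak convergence stated via bounded continuous test functions). -/
theorem ht_asymptotic_normality
    (p : ℝ) (hp0 : 0 < p) (hp1 : p < 1) (b : ℝ) (hb : 0 < b) (ctil : ℕ)
    (μ : (N : ℕ) → Fin N → (Fin N → Bool) → ℝ)
    (B : (N : ℕ) → Fin N → Finset (Fin N))
    (hbound : ∀ N (i : Fin N) (z : Fin N → Bool), |μ N i z| ≤ b)
    (hself : ∀ N (i : Fin N), i ∈ B N i)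
    (hdep : ∀ N, ∀ i j : Fin N, j ∉ B N i →
      (∀ z, μ N i (Function.update z j false) = μ N i (Function.update z j true)) ∧
      (∀ z, μ N j (Function.update z i false) = μ N j (Function.update z i true)) ∧
      (∀ a c : Bool,
        (∫ z, (μ N i (Function.update z i a) * μ N j (Function.update z j c)) ∂ bernPi N p)
          - (∫ z, μ N i (Function.update z i a) ∂ bernPi N p)
            * (∫ z, μ N j (Function.update z j c) ∂ bernPi N p) = 0))
    (hcard : ∀ N (i : Fin N), (B N i).card ≤ ctil)
    (hindep : ∀ N, ∀ i : Fin N,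
      Indep (MeasurableSpace.comap (Ufun N p (μ N) i) inferInstance)
        (⨆ (j : Fin N) (_ : j ∉ B N i),
          MeasurableSpace.comap (Ufun N p (μ N) j) inferInstance)
        (bernPi N p))
    (V : ℝ) (hV : 0 < V)
    (hvar : Tendsto (fun N : ℕ => (N : ℝ) * variance (tauHatHT N p (μ N)) (bernPi N p))
      atTop (𝓝 V)) :
    ∀ f : BoundedContinuousFunction ℝ ℝ,
      Tendsto (fun N : ℕ =>
          ∫ z, f (Real.sqrt N * (tauHatHT N p (μ N) z - amr N p (μ N))) ∂ bernPi N p)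
        atTop (𝓝 (∫ x, f x ∂ gaussianReal 0 V.toNNReal)) := by
  have hbern := isProbabilityMeasure_bern hp0 hp1
  have hprob : ∀ N, IsProbabilityMeasure (bernPi N p) := fun N ↦ by unfold bernPi; infer_instance
  set K : ℝ := (1 / p + 1 / (1 - p) + 2) * b
  have hq : 0 < 1 - p := by linarith
  have hK0 : 0 ≤ K := by positivity
  set X : (N : ℕ) → Fin N → (Fin N → Bool) → ℝ :=
    fun N i z ↦ (Real.sqrt N)⁻¹ * Ufun N p (μ N) i z with hX
  have hS : ∀ (N : ℕ) z, Real.sqrt N * (tauHatHT N p (μ N) z - amr N p (μ N)) = ∑ i, X N i z :=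
    fun N z ↦ sqrt_mul_tauHatHT_sub_amr z
  have hXdep : ∀ N i, DependsOn (X N i) (mutualNeighbors (B N) i) := fun N i ↦ by
    have hi : i ∈ mutualNeighbors (B N) i := by simp [mutualNeighbors, hself N i]
    have hμ : DependsOn (μ N i) (mutualNeighbors (B N) i) :=
      dependsOn_of_forall_update_eq fun k hk ↦ by
        by_cases hki : k ∈ B N i
        · exact (hdep N k i fun hik ↦ hk (by simp [mutualNeighbors, hki, hik])).2.1
        · exact (hdep N i k hki).1
    intro x y h
    simp only [hX, Ufun, h i hi, hμ h]
  have hXmean : ∀ N i, ∫ z, X N i z ∂bernPi N p = 0 := fun N i ↦ by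
    simp only [hX]
    rw [integral_const_mul, integral_Ufun hp0 hp1, mul_zero]
  have hXbound : ∀ N i z, |X N i z| ≤ (Real.sqrt N)⁻¹ * K := fun N i z ↦ by
    rw [abs_mul, abs_of_nonneg (by positivity : 0 ≤ (Real.sqrt N)⁻¹)]
    gcongr
    exact abs_Ufun_le hp0 hp1 (hbound N) i z
  have hsq : ∀ N : ℕ, ∫ z, (∑ i, X N i z) ^ 2 ∂bernPi N p
      = (N : ℝ) * variance (tauHatHT N p (μ N)) (bernPi N p) := fun N ↦ by
    have hmean : ∫ z, ∑ i, X N i z ∂bernPi N p = 0 := by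
      rw [integral_finsetSum _ fun _ _ ↦ .of_finite]
      exact Finset.sum_eq_zero fun i _ ↦ hXmean N i
    rw [← variance_of_integral_eq_zero Measurable.of_discrete.aemeasurable hmean]
    simp_rw [← hS]
    rw [variance_const_mul, variance_sub_const Measurable.of_discrete.aestronglyMeasurable,
      Real.sq_sqrt N.cast_nonneg]
  set d := ctil * ctil
  set C : ℝ := 3 * d ^ 2 + 2 * d * ((d + 1) * d)
  have hcf : ∀ t : ℝ, Tendsto (fun N : ℕ ↦
      ∫ z, Complex.exp (Complex.I * (t * ∑ i, X N i z : ℝ)) ∂bernPi N p) atTop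
      (𝓝 (Real.exp (-(V * t ^ 2 / 2)))) := fun t ↦ by
    have hgauss : Tendsto (fun N : ℕ ↦
        ((Real.exp (-((∫ z, (∑ i, X N i z) ^ 2 ∂bernPi N p) * t ^ 2 / 2)) : ℝ) : ℂ)) atTop
        (𝓝 (Real.exp (-(V * t ^ 2 / 2)))) := by
      simp_rw [hsq]
      exact (Complex.continuous_ofReal.tendsto _).comp ((Real.continuous_exp.tendsto _).comp
        (((hvar.mul_const _).div_const _).neg))
    have hrate : Tendsto (fun N : ℕ ↦ C * K ^ 3 * t ^ 2 * |t| * (Real.sqrt N)⁻¹) atTop (𝓝 0) := by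
      simpa using ((tendsto_inv_atTop_zero.comp
        (Real.tendsto_sqrt_atTop.comp tendsto_natCast_atTop_atTop)).const_mul
          (C * K ^ 3 * t ^ 2 * |t|))
    refine (tendsto_iff_of_dist ?_).2 hgauss
    refine squeeze_zero (fun _ ↦ dist_nonneg) (fun N ↦ ?_) hrate
    rw [dist_eq_norm]
    refine (norm_integral_exp_sum_sub_gaussian_le (ν := fun _ : Fin N ↦ bern p) (hXdep N)
      (hXbound N) (by positivity) (card_meeting_mutualNeighbors_le (hcard N)) (hXmean N)
      t).trans_eq ?_
    rcases N.eq_zero_or_pos with rfl | hN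
    · simp
    have hN0 : (N : ℝ) = Real.sqrt N ^ 2 := (Real.sq_sqrt N.cast_nonneg).symm
    have hs : Real.sqrt N ≠ 0 := by positivity
    rw [Fintype.card_fin]
    nth_rewrite 1 [hN0]
    push_cast
    field_simp
    simp only [C, d]
    push_cast
    ring
  have hmeas : ∀ N, AEMeasurable (fun z ↦ ∑ i, X N i z) (bernPi N p) := fun N ↦
    Measurable.of_discrete.aemeasurable
  have hlim : Tendsto (β := ProbabilityMeasure ℝ) (fun N ↦ ⟨(bernPi N p).map (fun z ↦ ∑ i, X N i z),
      Measure.isProbabilityMeasure_map (hmeas N)⟩) atTop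
      (𝓝 ⟨gaussianReal 0 V.toNNReal, inferInstance⟩) := by
    refine ProbabilityMeasure.tendsto_iff_tendsto_charFun.2 fun t ↦ ?_
    simp only [ProbabilityMeasure.coe_mk, charFun_gaussianReal]
    convert hcf t using 2 with N
    · rw [charFun_apply_real, integral_map (hmeas N) (by fun_prop)]
      refine integral_congr_ae (Eventually.of_forall fun z ↦ ?_)
      simp only [Complex.ofReal_mul, mul_comm Complex.I]
    · push_cast
      rw [Real.coe_toNNReal V hV.le]
      ring_nf
  intro f
  have := ProbabilityMeasure.tendsto_iff_forall_integral_tendsto.1 hlim f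
  simp only [ProbabilityMeasure.coe_mk] at this
  refine this.congr fun N ↦ ?_
  rw [integral_map (hmeas N) f.continuous.aestronglyMeasurable]
  simp_rw [hS]
end

section
/- Asymptotic normality of the Hajek estimator (Proposition 3): Fix p ∈ (0,1), b > 0, and c̃ ∈ ℕ. For each N, let Z^{(N)} be an i.i.d. Bernoulli(p) vector of length N, let μ_{i,N} : {0,1}^N → ℝ satisfy |μ_{i,N}(z)| ≤ b for all i, N, z, and let B_N be a dependency structure for (μ_{1,N},…,μ_{N,N}) with |B_N(i)| ≤ c̃ for all i, N. Define U_{i,N} = (Z_i/p − (1−Z_i)/(1−p)) μ_{i,N}(Z^{(N)}) − (E[μ_{i,N}^{(1)}(Z^{(N)})] − E[μ_{i,N}^{(0)}(Z^{(N)})]), and assume that for each i and N the random variable U_{i,N} is independent of the family {U_{j,N} : j ∉ B_N(i)}. Define the Hajek estimator τ̂_{HA,N} = (1/N₁) Σ_i Z_i μ_{i,N}(Z^{(N)}) − (1/N₀) Σ_i (1−Z_i) μ_{i,N}(Z^{(N)}) where N₁ = Σ_i Z_i and N₀ = N − N₁ (with the convention τ̂_{HA,N} = 0 on the event N₁ ∈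 {0, N}), and let τ_N be the average marginalized response. Suppose N·Var(τ̂_{HA,N}) → V_{HA} as N → ∞ with V_{HA} > 0. Then √N (τ̂_{HA,N} − τ_N) converges in distribution to the Gaussian law with mean 0 and variance V_{HA}. -/
open MeasureTheory ProbabilityTheory Filter Topology

/-- Hajek estimator, with the convention that it equals `0` on the event
`N₁ ∈ {0, N}`. -/
noncomputable def tauHatHA (N : ℕ) (μ : Fin N → (Fin N → Bool) → ℝ)
    (z : Fin N → Bool) : ℝ :=
  if (Finset.univ.filter fun i => z i = true).card = 0
      ∨ (Finset.univ.filter fun i => z i = true).card = N then 0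
  else
    ((1 / ((Finset.univ.filter fun i => z i = true).card : ℝ)) *
        ∑ i, (if z i then (1 : ℝ) else 0) * μ i z)
      - (1 / ((N - (Finset.univ.filter fun i => z i = true).card : ℕ) : ℝ)) *
          ∑ i, (1 - if z i then (1 : ℝ) else 0) * μ i z

section BernoulliProduct

variable {E : Type*} [NormedAddCommGroup E] [NormedSpace ℝ E]

lemma isProbabilityMeasure_bern_s17 {p : ℝ} (h0 : 0 ≤ p) (h1 : p ≤ 1) :
    IsProbabilityMeasure (bern p) := by
  constructor
  simp only [bern, Measure.coe_add, Measure.coe_smul, Pi.add_apply, Pi.smul_apply,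
    measure_univ, smul_eq_mul, mul_one]
  rw [← ENNReal.ofReal_add h0 (by linarith)]
  simp

instance isFiniteMeasure_bern (p : ℝ) : IsFiniteMeasure (bern p) := by
  constructor
  simp [bern]

instance isFiniteMeasure_bernPi (N : ℕ) (p : ℝ) : IsFiniteMeasure (bernPi N p) := by
  unfold bernPi; infer_instance

lemma isProbabilityMeasure_bernPi (N : ℕ) {p : ℝ} (h0 : 0 ≤ p) (h1 : p ≤ 1) :
    IsProbabilityMeasure (bernPi N p) := by
  have := isProbabilityMeasure_bern_s17 h0 h1
  unfold bernPi; infer_instance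

omit [NormedSpace ℝ E] in
lemma integrable_bernPi {N : ℕ} {p : ℝ} (F : (Fin N → Bool) → E) :
    Integrable F (bernPi N p) := .of_finite

lemma integral_bern_s17 [CompleteSpace E] {p : ℝ} (h0 : 0 ≤ p) (h1 : p ≤ 1) (F : Bool → E) :
    ∫ a, F a ∂ bern p = p • F true + (1 - p) • F false := by
  have h (c : ℝ) (a : Bool) : IsFiniteMeasure (ENNReal.ofReal c • Measure.dirac a) :=
    Measure.smul_finite _ ENNReal.ofReal_ne_top
  rw [bern, integral_add_measure .of_finite .of_finite, integral_smul_measure,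
    integral_smul_measure, integral_dirac, integral_dirac,
    ENNReal.toReal_ofReal h0, ENNReal.toReal_ofReal (by linarith)]

/-- Conditioning on the first coordinate. -/
lemma integral_bernPi_succ [CompleteSpace E] {n : ℕ} {p : ℝ} (h0 : 0 ≤ p) (h1 : p ≤ 1)
    (F : (Fin (n + 1) → Bool) → E) :
    ∫ z, F z ∂ bernPi (n + 1) p =
      p • (∫ z, F (Fin.cons true z) ∂ bernPi n p)
        + (1 - p) • ∫ z, F (Fin.cons false z) ∂ bernPi n p := by
  have := isProbabilityMeasure_bern_s17 h0 h1
  have hm := (measurePreserving_piFinSuccAbove (fun _ : Fin (n + 1) => bern p) 0).symm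
  unfold bernPi
  rw [← hm.integral_comp', integral_prod _ .of_finite, integral_bern_s17 h0 h1]
  simp only [MeasurableEquiv.piFinSuccAbove_symm_apply, Fin.insertNthEquiv_zero]
  rfl

/-- Resampling a single coordinate. -/
lemma integral_bernPi_update [CompleteSpace E] {n : ℕ} {p : ℝ} (h0 : 0 ≤ p) (h1 : p ≤ 1)
    (F : (Fin n → Bool) → E) (k : Fin n) :
    ∫ z, F z ∂ bernPi n p =
      p • (∫ z, F (Function.update z k true) ∂ bernPi n p)
        + (1 - p) • ∫ z, F (Function.update z k false) ∂ bernPi n p := by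
  induction n with
  | zero => exact k.elim0
  | succ n ih =>
    refine Fin.cases ?_ (fun j => ?_) k
    · rw [integral_bernPi_succ h0 h1 F, integral_bernPi_succ h0 h1, integral_bernPi_succ h0 h1]
      simp only [Fin.update_cons_zero]
      module
    · rw [integral_bernPi_succ h0 h1 F, integral_bernPi_succ h0 h1, integral_bernPi_succ h0 h1]
      simp only [← Fin.cons_update]
      rw [ih (fun z => F (Fin.cons true z)) j, ih (fun z => F (Fin.cons false z)) j]
      module

/-- If every coordinate is irrelevant to one of two functions then they are uncorrelated. -/
lemma integral_mul_eq_of_disjoint {n : ℕ} {p : ℝ} (h0 : 0 ≤ p) (h1 : p ≤ 1)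
    (F G : (Fin n → Bool) → ℂ)
    (h : ∀ k, (∀ z a, F (Function.update z k a) = F z) ∨
      (∀ z a, G (Function.update z k a) = G z)) :
    ∫ z, F z * G z ∂ bernPi n p = (∫ z, F z ∂ bernPi n p) * ∫ z, G z ∂ bernPi n p := by
  induction n with
  | zero =>
    have := isProbabilityMeasure_bernPi 0 h0 h1
    have hF : ∀ z, F z = F default := fun z => by rw [Subsingleton.elim z default]
    have hG : ∀ z, G z = G default := fun z => by rw [Subsingleton.elim z default]
    simp [hF, hG]
  | succ n ih =>
    have key : ∀ a, ∫ z, F (Fin.cons a z) * G (Fin.cons a z) ∂ bernPi n p =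
        (∫ z, F (Fin.cons a z) ∂ bernPi n p) * ∫ z, G (Fin.cons a z) ∂ bernPi n p := by
      intro a
      refine ih _ _ fun k => ?_
      simp only [Fin.cons_update]
      exact (h k.succ).imp (fun H z b => H _ _) (fun H z b => H _ _)
    rw [integral_bernPi_succ h0 h1, integral_bernPi_succ h0 h1, integral_bernPi_succ h0 h1,
      key, key]
    rcases h 0 with H | H
    · have e (z : Fin n → Bool) :
          F (Fin.cons true z : Fin (n + 1) → Bool) = F (Fin.cons false z) := by
        rw [← H (Fin.cons false z) true, Fin.update_cons_zero]
      simp only [e, Complex.real_smul]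
      push_cast; ring
    · have e (z : Fin n → Bool) :
          G (Fin.cons true z : Fin (n + 1) → Bool) = G (Fin.cons false z) := by
        rw [← H (Fin.cons false z) true, Fin.update_cons_zero]
      simp only [e, Complex.real_smul]
      push_cast; ring

lemma sq_integral_le {n : ℕ} {p : ℝ} (h0 : 0 ≤ p) (h1 : p ≤ 1) (F : (Fin n → Bool) → ℝ) :
    (∫ z, F z ∂ bernPi n p) ^ 2 ≤ ∫ z, F z ^ 2 ∂ bernPi n p := by
  have := isProbabilityMeasure_bernPi n h0 h1
  have h := variance_nonneg F (bernPi n p)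
  rw [variance_eq_sub .of_discrete] at h
  simpa using h

/-- The Poincaré (Efron–Stein) inequality. -/
lemma poincare_bernPi {n : ℕ} {p : ℝ} (h0 : 0 ≤ p) (h1 : p ≤ 1) (F : (Fin n → Bool) → ℝ) :
    ∫ z, F z ^ 2 ∂ bernPi n p - (∫ z, F z ∂ bernPi n p) ^ 2 ≤
      ∑ k, ∫ z, (F (Function.update z k true) - F (Function.update z k false)) ^ 2
        ∂ bernPi n p := by
  induction n with
  | zero =>
    have := isProbabilityMeasure_bernPi 0 h0 h1
    have hF : ∀ z, F z = F default := fun z => by rw [Subsingleton.elim z default]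
    simp [hF]
  | succ n ih =>
    have i1 := ih (fun z => F (Fin.cons true z))
    have i0 := ih (fun z => F (Fin.cons false z))
    rw [Fin.sum_univ_succ]
    simp only [integral_bernPi_succ h0 h1, Fin.update_cons_zero, ← Fin.cons_update, smul_eq_mul,
      Finset.sum_add_distrib, ← Finset.mul_sum]
    have hd := sq_integral_le h0 h1 (fun z : Fin n → Bool =>
      F (Fin.cons true z : Fin (n + 1) → Bool) - F (Fin.cons false z))
    rw [integral_sub (integrable_bernPi _) (integrable_bernPi _)] at hd
    have hd0 := (sq_nonneg _).trans hd
    have hq : 0 ≤ 1 - p := by linarith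
    have a1 := mul_le_mul_of_nonneg_left i1 h0
    have a0 := mul_le_mul_of_nonneg_left i0 hq
    have a2 := mul_le_mul_of_nonneg_left hd (mul_nonneg h0 hq)
    have a3 : p * (1 - p) ≤ 1 := by nlinarith
    have a4 := mul_le_mul_of_nonneg_right a3 hd0
    nlinarith

end BernoulliProduct

section BoundedDifferences

variable {n : ℕ} {p : ℝ}

lemma integral_bernPi_mono {F G : (Fin n → Bool) → ℝ} (h : ∀ z, F z ≤ G z) :
    ∫ z, F z ∂ bernPi n p ≤ ∫ z, G z ∂ bernPi n p :=
  integral_mono (integrable_bernPi _) (integrable_bernPi _) h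

lemma variance_le_of_bounded_differences (h0 : 0 ≤ p) (h1 : p ≤ 1) {F : (Fin n → Bool) → ℝ}
    {D : ℝ} (hF : ∀ k z a, |F (Function.update z k a) - F z| ≤ D) :
    ∫ z, F z ^ 2 ∂ bernPi n p - (∫ z, F z ∂ bernPi n p) ^ 2 ≤ n * D ^ 2 := by
  have := isProbabilityMeasure_bernPi n h0 h1
  refine (poincare_bernPi h0 h1 F).trans ?_
  calc _ ≤ ∑ k : Fin n, ∫ z, D ^ 2 ∂ bernPi n p := by
        refine Finset.sum_le_sum fun k _ => integral_bernPi_mono fun z => ?_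
        have h := hF k (Function.update z k false) true
        rw [Function.update_idem] at h
        exact sq_le_sq' (by linarith [(abs_le.1 h).1]) (abs_le.1 h).2
    _ = n * D ^ 2 := by simp

lemma fourth_moment_le_of_bounded_differences (h0 : 0 ≤ p) (h1 : p ≤ 1)
    {F : (Fin n → Bool) → ℝ} {D : ℝ}
    (hF : ∀ k z a, |F (Function.update z k a) - F z| ≤ D) (hF0 : ∫ z, F z ∂ bernPi n p = 0) :
    ∫ z, F z ^ 4 ∂ bernPi n p ≤ 17 * n ^ 2 * D ^ 4 := by
  have := isProbabilityMeasure_bernPi n h0 h1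
  have hv := variance_le_of_bounded_differences h0 h1 hF
  rw [hF0] at hv
  have hP := poincare_bernPi h0 h1 (fun z => F z ^ 2)
  have hnn : 0 ≤ ∫ z, F z ^ 2 ∂ bernPi n p := integral_nonneg fun z => sq_nonneg _
  have hsum : ∑ k, ∫ z, (F (Function.update z k true) ^ 2 - F (Function.update z k false) ^ 2) ^ 2
      ∂ bernPi n p ≤ n * (8 * D ^ 2 * (∫ z, F z ^ 2 ∂ bernPi n p) + 8 * D ^ 4) := by
    calc _ ≤ ∑ k : Fin n, ∫ z, (8 * D ^ 2 * F z ^ 2 + 8 * D ^ 4) ∂ bernPi n p := by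
          refine Finset.sum_le_sum fun k _ => integral_bernPi_mono fun z => ?_
          have h := hF k (Function.update z k false) true
          rw [Function.update_idem] at h
          have ht := hF k z true
          have hf := hF k z false
          have hD : 0 ≤ D := (abs_nonneg _).trans h
          set x := F (Function.update z k true)
          set y := F (Function.update z k false)
          have e1 : (x - y) ^ 2 ≤ D ^ 2 :=
            sq_le_sq' (by linarith [(abs_le.1 h).1]) (abs_le.1 h).2
          have e2 : (x + y - 2 * F z) ^ 2 ≤ (2 * D) ^ 2 := by
            rw [abs_le] at ht hf
            exact sq_le_sq' (by linarith) (by linarith)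
          have e3 : (x + y) ^ 2 ≤ 8 * F z ^ 2 + 8 * D ^ 2 := by
            nlinarith [sq_nonneg (x + y - 4 * F z)]
          calc (x ^ 2 - y ^ 2) ^ 2 = (x - y) ^ 2 * (x + y) ^ 2 := by ring
            _ ≤ D ^ 2 * (8 * F z ^ 2 + 8 * D ^ 2) :=
              mul_le_mul e1 e3 (sq_nonneg _) (sq_nonneg _)
            _ = _ := by ring
      _ = _ := by
        rw [integral_add (integrable_bernPi _) (integrable_bernPi _), integral_const_mul]
        simp [mul_add]
  have e : ∀ z, (F z ^ 2) ^ 2 = F z ^ 4 := fun z => by ring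
  simp only [e] at hP
  have hm : (∫ z, F z ^ 2 ∂ bernPi n p) ≤ n * D ^ 2 := by simpa using hv
  have hm2 : (∫ z, F z ^ 2 ∂ bernPi n p) ^ 2 ≤ (n * D ^ 2) ^ 2 :=
    pow_le_pow_left₀ hnn hm 2
  have hn1 : (n : ℝ) ≤ (n : ℝ) ^ 2 := by exact_mod_cast Nat.le_self_pow two_ne_zero n
  have h8 : (n : ℝ) * (8 * D ^ 2 * (∫ z, F z ^ 2 ∂ bernPi n p)) ≤
      n * (8 * D ^ 2 * (n * D ^ 2)) := by gcongr
  have h9 : (n : ℝ) * (8 * D ^ 4) ≤ n ^ 2 * (8 * D ^ 4) := by gcongr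
  nlinarith

lemma abs_sum_update_sub_le {X : Fin n → (Fin n → Bool) → ℝ} {K : ℝ}
    (hX : ∀ i z, |X i z| ≤ K) {m : ℕ} (M : Fin n → Finset (Fin n)) (hM : ∀ k, (M k).card ≤ m)
    (hdep : ∀ k, ∀ i ∉ M k, ∀ z a, X i (Function.update z k a) = X i z) (k : Fin n)
    (z : Fin n → Bool) (a : Bool) :
    |(∑ i, X i (Function.update z k a)) - ∑ i, X i z| ≤ m * (2 * K) := by
  have hK : 0 ≤ K := (abs_nonneg _).trans (hX k z)
  rw [← Finset.sum_sub_distrib, ← Finset.sum_subset (Finset.subset_univ (M k))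
    fun i _ hi => by rw [hdep k i hi, sub_self]]
  calc _ ≤ ∑ i ∈ M k, |X i (Function.update z k a) - X i z| := Finset.abs_sum_le_sum_abs _ _
    _ ≤ ∑ i ∈ M k, 2 * K := Finset.sum_le_sum fun i _ => by
        linarith [abs_sub (X i (Function.update z k a)) (X i z), hX i z,
          hX i (Function.update z k a)]
    _ = (M k).card * (2 * K) := by simp
    _ ≤ _ := by
      have : ((M k).card : ℝ) ≤ m := by exact_mod_cast hM k
      gcongr

end BoundedDifferences

section LocalDependence

lemma norm_exp_ofReal_mul_I_sub_one_sub_le (x : ℝ) :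
    ‖Complex.exp (x * Complex.I) - 1 - x * Complex.I‖ ≤ 3 * x ^ 2 := by
  have hx : ‖(x : ℂ) * Complex.I‖ = |x| := by simp
  rcases le_total |x| 1 with h | h
  · have := Complex.norm_exp_sub_one_sub_id_le (hx.trans_le h)
    rw [hx, sq_abs] at this
    nlinarith [sq_nonneg x]
  · have h2 : 1 ≤ x ^ 2 := by rw [← sq_abs]; nlinarith
    have h3 : |x| ≤ x ^ 2 := by rw [← sq_abs]; nlinarith
    calc _ ≤ ‖Complex.exp (x * Complex.I)‖ + ‖(1 : ℂ)‖ + ‖(x : ℂ) * Complex.I‖ :=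
          (norm_sub_le _ _).trans (add_le_add_left (norm_sub_le _ _) _)
      _ ≤ _ := by rw [Complex.norm_exp_ofReal_mul_I, hx, norm_one]; linarith

variable {n : ℕ} {p : ℝ}

lemma hasDerivAt_integral_exp_mul_I (T : (Fin n → Bool) → ℝ) (t : ℝ) :
    HasDerivAt (fun s : ℝ => ∫ z, Complex.exp ((s * T z : ℝ) * Complex.I) ∂ bernPi n p)
      (∫ z, (T z * Complex.I) * Complex.exp ((t * T z : ℝ) * Complex.I) ∂ bernPi n p) t := by
  simp only [integral_fintype (integrable_bernPi _)]
  refine HasDerivAt.fun_sum fun z _ => HasDerivAt.const_smul _ ?_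
  have h1 : HasDerivAt (fun s : ℝ => ((s * T z : ℝ) : ℂ) * Complex.I) (T z * Complex.I) t := by
    have := ((hasDerivAt_id t).mul_const (T z)).ofReal_comp.mul_const Complex.I
    simpa using this
  simpa [mul_comm] using h1.cexp

lemma norm_integral_bernPi_le {F : (Fin n → Bool) → ℂ} {G : (Fin n → Bool) → ℝ}
    (h : ∀ z, ‖F z‖ ≤ G z) : ‖∫ z, F z ∂ bernPi n p‖ ≤ ∫ z, G z ∂ bernPi n p :=
  norm_integral_le_of_norm_le (integrable_bernPi _) (ae_of_all _ h)

lemma abs_sum_le_card_mul {ι : Type*} {s : Finset ι} {m : ℕ} (hs : s.card ≤ m) {f : ι → ℝ} {K : ℝ}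
    (hK : 0 ≤ K) (hf : ∀ i, |f i| ≤ K) : |∑ i ∈ s, f i| ≤ m * K := by
  calc _ ≤ ∑ i ∈ s, |f i| := Finset.abs_sum_le_sum_abs _ _
    _ ≤ ∑ i ∈ s, K := Finset.sum_le_sum fun i _ => hf i
    _ = s.card * K := by simp
    _ ≤ _ := by
      have : (s.card : ℝ) ≤ m := by exact_mod_cast hs
      gcongr

variable {c : ℕ} {K : ℝ} {S : Fin n → Finset (Fin n)} {X : Fin n → (Fin n → Bool) → ℝ}

/-- Stein's equation for the characteristic function of a sum of centered, bounded and locally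
dependent summands. -/
lemma stein_charFun_bound (h0 : 0 ≤ p) (h1 : p ≤ 1)
    (hrefl : ∀ i, i ∈ S i) (hsymm : ∀ i j, i ∈ S j → j ∈ S i) (hcard : ∀ i, (S i).card ≤ c)
    (hK : 0 ≤ K) (hX : ∀ i z, |X i z| ≤ K)
    (hdep : ∀ k, ∀ i ∉ S k, ∀ z a, X i (Function.update z k a) = X i z)
    (hmean : ∀ i, ∫ z, X i z ∂ bernPi n p = 0) (t : ℝ) :
    ‖(∫ z, ((∑ i, X i z : ℝ) * Complex.I) *
          Complex.exp ((t * ∑ i, X i z : ℝ) * Complex.I) ∂ bernPi n p)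
        + t * (∫ z, (∑ i, X i z) ^ 2 ∂ bernPi n p : ℝ) *
          ∫ z, Complex.exp ((t * ∑ i, X i z : ℝ) * Complex.I) ∂ bernPi n p‖
      ≤ |t| * (√n * (2 * c ^ 5 * K ^ 2)) + n * (3 * c ^ 4 * K ^ 3 * t ^ 2) := by
  have := isProbabilityMeasure_bernPi n h0 h1
  set T : (Fin n → Bool) → ℝ := fun z => ∑ i, X i z with hT
  set e : (Fin n → Bool) → ℂ := fun z => Complex.exp ((t * T z : ℝ) * Complex.I) with he
  have hen : ∀ z, ‖e z‖ = 1 := fun z => Complex.norm_exp_ofReal_mul_I _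
  let nb : Fin n → Finset (Fin n) := fun i => (S i).biUnion S
  have hnb : ∀ i j, j ∈ nb i ↔ ∃ k ∈ S i, j ∈ S k := fun i j => Finset.mem_biUnion
  have hnbc : ∀ i, (nb i).card ≤ c * c := fun i =>
    (Finset.card_biUnion_le_card_mul _ _ _ fun k _ => hcard k).trans
      (Nat.mul_le_mul_right _ (hcard i))
  let Y : Fin n → (Fin n → Bool) → ℝ := fun i z => ∑ j ∈ nb i, X j z
  have hY : ∀ i z, |Y i z| ≤ c ^ 2 * K := fun i z => by
    have := abs_sum_le_card_mul (hnbc i) hK (fun j => hX j z)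
    rw [pow_two]; exact_mod_cast this
  have hTY : ∀ i, ∀ k ∈ S i, ∀ z a,
      T (Function.update z k a) - Y i (Function.update z k a) = T z - Y i z := by
    intro i k hk z a
    simp only [hT, Y]
    rw [← Finset.sum_add_sum_compl (nb i) (fun j => X j z),
      ← Finset.sum_add_sum_compl (nb i) (fun j => X j (Function.update z k a)),
      add_sub_cancel_left, add_sub_cancel_left]
    refine Finset.sum_congr rfl fun j hj => hdep k j (fun hjk => ?_) z a
    exact Finset.mem_compl.1 hj ((hnb i j).2 ⟨k, hk, hjk⟩)
  have hfac : ∀ i (g : ℝ → ℂ), ∫ z, (X i z : ℂ) * g (T z - Y i z) ∂ bernPi n p = 0 := by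
    intro i g
    rw [integral_mul_eq_of_disjoint h0 h1 (fun z => (X i z : ℂ)), integral_complex_ofReal, hmean i]
    · simp
    · intro k
      by_cases hk : k ∈ S i
      · exact .inr fun z a => by rw [hTY i k hk]
      · exact .inl fun z a => by rw [hdep k i fun h => hk (hsymm _ _ h)]
  let Q : (Fin n → Bool) → ℝ := fun z => ∑ i, X i z * Y i z
  have hEQ : ∫ z, Q z ∂ bernPi n p = ∫ z, T z ^ 2 ∂ bernPi n p := by
    have e1 : ∀ z, T z ^ 2 = Q z + ∑ i, X i z * (T z - Y i z) := fun z => by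
      simp only [Q, mul_sub, Finset.sum_sub_distrib, ← Finset.sum_mul]
      simp only [hT]; ring
    simp only [e1]
    rw [integral_add (integrable_bernPi _) (integrable_bernPi _), left_eq_add,
      integral_finsetSum _ fun i _ => integrable_bernPi _]
    refine Finset.sum_eq_zero fun i _ => ?_
    have := hfac i (fun x => x)
    simp only [← Complex.ofReal_mul] at this
    rw [integral_complex_ofReal] at this
    exact_mod_cast this
  have hQd : ∀ k z a, |Q (Function.update z k a) - Q z| ≤ 2 * c ^ 5 * K ^ 2 := by
    intro k z a
    have hXY : ∀ i z, |X i z * Y i z| ≤ K * (c ^ 2 * K) := fun i z => by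
      rw [abs_mul]
      exact mul_le_mul (hX i z) (hY i z) (abs_nonneg _) hK
    have hMc : ∀ k, ((S k).biUnion nb).card ≤ c * (c * c) := fun k =>
      (Finset.card_biUnion_le_card_mul _ _ _ fun k _ => hnbc k).trans
        (Nat.mul_le_mul_right _ (hcard k))
    refine (abs_sum_update_sub_le hXY (fun k => (S k).biUnion nb) hMc ?_ k z a).trans_eq ?_
    · intro k i hi z a
      have hi' : ∀ j ∈ S k, i ∉ nb j := by simpa using hi
      rw [hdep k i fun h => hi' i h ((hnb i i).2 ⟨i, hrefl i, hrefl i⟩)]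
      congr 1
      refine Finset.sum_congr rfl fun j hj => hdep k j (fun hjk => hi' j hjk ?_) z a
      obtain ⟨l, hl, hjl⟩ := (hnb i j).1 hj
      exact (hnb j i).2 ⟨l, hsymm _ _ hjl, hsymm _ _ hl⟩
    · push_cast; ring
  have hQabs : ∫ z, |Q z - ∫ w, T w ^ 2 ∂ bernPi n p| ∂ bernPi n p ≤
      √n * (2 * c ^ 5 * K ^ 2) := by
    have hv := variance_le_of_bounded_differences h0 h1
      (F := fun z => Q z - ∫ w, T w ^ 2 ∂ bernPi n p) (by simpa using hQd)
    have hz : ∫ z, (Q z - ∫ w, T w ^ 2 ∂ bernPi n p) ∂ bernPi n p = 0 := by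
      rw [integral_sub (integrable_bernPi _) (integrable_bernPi _), hEQ]; simp
    have hs := sq_integral_le h0 h1 (fun z => |Q z - ∫ w, T w ^ 2 ∂ bernPi n p|)
    simp only [sq_abs] at hs
    rw [hz] at hv
    refine abs_le_of_sq_le_sq' ?_ (by positivity) |>.2
    rw [mul_pow, Real.sq_sqrt (Nat.cast_nonneg n)]
    linarith
  have hterm : ∀ i, ‖∫ z, ((X i z : ℂ) * e z - (t * Complex.I) * ((X i z * Y i z : ℝ) * e z))
      ∂ bernPi n p‖ ≤ 3 * c ^ 4 * K ^ 3 * t ^ 2 := by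
    intro i
    have hsplit : ∀ z, (X i z : ℂ) * e z - (t * Complex.I) * ((X i z * Y i z : ℝ) * e z) =
        (X i z : ℂ) * Complex.exp ((t * (T z - Y i z) : ℝ) * Complex.I) -
        (X i z : ℂ) * e z * (Complex.exp ((-(t * Y i z) : ℝ) * Complex.I) - 1 -
          (-(t * Y i z) : ℝ) * Complex.I) := by
      intro z
      have : Complex.exp ((t * (T z - Y i z) : ℝ) * Complex.I) =
          e z * Complex.exp ((-(t * Y i z) : ℝ) * Complex.I) := by
        rw [he, ← Complex.exp_add]; congr 1; push_cast; ring
      rw [this]; push_cast; ring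
    simp only [hsplit]
    rw [integral_sub (integrable_bernPi _) (integrable_bernPi _),
      hfac i (fun x => Complex.exp ((t * x : ℝ) * Complex.I)), zero_sub, norm_neg]
    refine (norm_integral_bernPi_le (G := fun _ => 3 * c ^ 4 * K ^ 3 * t ^ 2) fun z => ?_).trans
      (by simp)
    rw [norm_mul, norm_mul, hen, mul_one, Complex.norm_real, Real.norm_eq_abs]
    calc _ ≤ K * (3 * (-(t * Y i z)) ^ 2) :=
          mul_le_mul (hX i z) (norm_exp_ofReal_mul_I_sub_one_sub_le _) (norm_nonneg _) hK
      _ = K * (3 * (t ^ 2 * |Y i z| ^ 2)) := by rw [sq_abs]; ring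
      _ ≤ K * (3 * (t ^ 2 * (c ^ 2 * K) ^ 2)) := by gcongr; exact hY i z
      _ = _ := by ring
  have hsum : ‖∫ z, ((T z : ℂ) * e z - (t * Complex.I) * ((Q z : ℝ) * e z)) ∂ bernPi n p‖ ≤
      n * (3 * c ^ 4 * K ^ 3 * t ^ 2) := by
    have : ∀ z, (T z : ℂ) * e z - (t * Complex.I) * ((Q z : ℝ) * e z) =
        ∑ i, ((X i z : ℂ) * e z - (t * Complex.I) * ((X i z * Y i z : ℝ) * e z)) := fun z => by
      rw [Finset.sum_sub_distrib, ← Finset.sum_mul, ← Finset.mul_sum, ← Finset.sum_mul]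
      simp only [hT, Q]; push_cast; rfl
    simp only [this]
    rw [integral_finsetSum _ fun i _ => integrable_bernPi _]
    refine (norm_sum_le _ _).trans ((Finset.sum_le_sum fun i _ => hterm i).trans_eq ?_)
    simp
  have hQe : ‖∫ z, ((Q z - ∫ w, T w ^ 2 ∂ bernPi n p : ℝ) : ℂ) * e z ∂ bernPi n p‖ ≤
      √n * (2 * c ^ 5 * K ^ 2) := by
    refine (norm_integral_bernPi_le fun z => ?_).trans hQabs
    rw [norm_mul, hen, mul_one, Complex.norm_real, Real.norm_eq_abs]
  have hdecomp : (∫ z, ((T z : ℂ) * Complex.I) * e z ∂ bernPi n p)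
        + t * (∫ z, T z ^ 2 ∂ bernPi n p : ℝ) * ∫ z, e z ∂ bernPi n p =
      Complex.I * (∫ z, ((T z : ℂ) * e z - (t * Complex.I) * ((Q z : ℝ) * e z)) ∂ bernPi n p)
      - t * ∫ z, ((Q z - ∫ w, T w ^ 2 ∂ bernPi n p : ℝ) : ℂ) * e z ∂ bernPi n p := by
    rw [← integral_const_mul, ← integral_const_mul, ← integral_const_mul,
      ← integral_add (integrable_bernPi _) (integrable_bernPi _),
      ← integral_sub (integrable_bernPi _) (integrable_bernPi _)]
    congr 1; ext z
    push_cast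
    linear_combination (t * Q z * e z : ℂ) * Complex.I_sq
  rw [hdecomp]
  refine (norm_sub_le _ _).trans ?_
  rw [norm_mul, norm_mul, Complex.norm_I, one_mul, Complex.norm_real, Real.norm_eq_abs, add_comm]
  gcongr

/-- A quantitative central limit theorem, on characteristic functions, for sums of locally
dependent summands. -/
lemma norm_charFun_sum_sub_le (h0 : 0 ≤ p) (h1 : p ≤ 1)
    (hrefl : ∀ i, i ∈ S i) (hsymm : ∀ i j, i ∈ S j → j ∈ S i) (hcard : ∀ i, (S i).card ≤ c)
    (hK : 0 ≤ K) (hX : ∀ i z, |X i z| ≤ K)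
    (hdep : ∀ k, ∀ i ∉ S k, ∀ z a, X i (Function.update z k a) = X i z)
    (hmean : ∀ i, ∫ z, X i z ∂ bernPi n p = 0) (t : ℝ) :
    ‖(∫ z, Complex.exp ((t * ∑ i, X i z : ℝ) * Complex.I) ∂ bernPi n p)
        - Complex.exp ((-((∫ z, (∑ i, X i z) ^ 2 ∂ bernPi n p) * t ^ 2 / 2) : ℝ))‖
      ≤ (|t| * (√n * (2 * c ^ 5 * K ^ 2)) + n * (3 * c ^ 4 * K ^ 3 * t ^ 2)) * |t| := by
  have := isProbabilityMeasure_bernPi n h0 h1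
  set v := ∫ z, (∑ i, X i z) ^ 2 ∂ bernPi n p with hv
  have hv0 : 0 ≤ v := integral_nonneg fun z => sq_nonneg _
  set φ : ℝ → ℂ := fun s => ∫ z, Complex.exp ((s * ∑ i, X i z : ℝ) * Complex.I) ∂ bernPi n p
    with hφ
  set R := |t| * (√n * (2 * c ^ 5 * K ^ 2)) + n * (3 * c ^ 4 * K ^ 3 * t ^ 2) with hR
  let ψ : ℝ → ℂ := fun s => φ s * Complex.exp ((v * s ^ 2 / 2 : ℝ))
  have hψ : ∀ s, HasDerivAt ψ
      (((∫ z, ((∑ i, X i z : ℝ) * Complex.I) *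
          Complex.exp ((s * ∑ i, X i z : ℝ) * Complex.I) ∂ bernPi n p) + s * v * φ s) *
        Complex.exp ((v * s ^ 2 / 2 : ℝ))) s := by
    intro s
    have d1 := hasDerivAt_integral_exp_mul_I (p := p) (fun z => ∑ i, X i z) s
    have d2 : HasDerivAt (fun s : ℝ => ((v * s ^ 2 / 2 : ℝ) : ℂ)) ((v * s : ℝ) : ℂ) s := by
      have := (((hasDerivAt_pow 2 s).const_mul v).div_const 2).ofReal_comp
      convert! this using 2
      simp; ring
    convert! d1.mul d2.cexp using 1
    rw [Complex.ofReal_mul]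
    exact (fun (A P E x y : ℂ) =>
      (by ring : (A + x * y * P) * E = A * E + P * (E * (y * x)))) _ _ _ _ _
  have hbd : ∀ s ∈ Set.Icc (-|t|) |t|, ‖((∫ z, ((∑ i, X i z : ℝ) * Complex.I) *
          Complex.exp ((s * ∑ i, X i z : ℝ) * Complex.I) ∂ bernPi n p) + s * v * φ s) *
        Complex.exp ((v * s ^ 2 / 2 : ℝ))‖ ≤ R * Real.exp (v * t ^ 2 / 2) := by
    intro s hs
    have hst : |s| ≤ |t| := abs_le.2 hs
    have hst2 : s ^ 2 ≤ t ^ 2 := sq_le_sq.2 hst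
    rw [norm_mul, ← Complex.ofReal_exp, Complex.norm_real, Real.norm_eq_abs, Real.abs_exp]
    refine mul_le_mul ((stein_charFun_bound h0 h1 hrefl hsymm hcard hK hX hdep hmean s).trans ?_)
      ?_ (Real.exp_pos _).le (by positivity)
    · rw [hR]; gcongr
    · gcongr
  have hmv := (convex_Icc (-|t|) |t|).norm_image_sub_le_of_norm_hasDerivWithin_le
    (fun s _ => (hψ s).hasDerivWithinAt) hbd
    (x := 0) (y := t) (by simp) (abs_le.1 le_rfl)
  have hψ0 : ψ 0 = 1 := by simp [ψ, φ]
  have hψt : φ t - Complex.exp ((-(v * t ^ 2 / 2) : ℝ)) =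
      (ψ t - ψ 0) * Complex.exp ((-(v * t ^ 2 / 2) : ℝ)) := by
    rw [hψ0]
    simp only [ψ]
    rw [sub_mul, mul_assoc, ← Complex.exp_add]
    simp
  rw [hψt, norm_mul, ← Complex.ofReal_exp, Complex.norm_real, Real.norm_eq_abs, Real.abs_exp]
  rw [sub_zero, Real.norm_eq_abs] at hmv
  calc _ ≤ R * Real.exp (v * t ^ 2 / 2) * |t| * Real.exp (-(v * t ^ 2 / 2)) := by gcongr
    _ = R * |t| * (Real.exp (v * t ^ 2 / 2) * Real.exp (-(v * t ^ 2 / 2))) := by ring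
    _ = R * |t| := by rw [← Real.exp_add]; simp

end LocalDependence

section Hajek

variable {N : ℕ} {p b : ℝ} {c : ℕ}

/-- The real-valued treatment indicator. -/
noncomputable def treat (z : Fin N → Bool) (i : Fin N) : ℝ := if z i then 1 else 0

lemma treat_update_self (z : Fin N → Bool) (i : Fin N) (a : Bool) :
    treat (Function.update z i a) i = if a then 1 else 0 := by
  simp [treat]

lemma treat_update_of_ne {i k : Fin N} (h : i ≠ k) (z : Fin N → Bool) (a : Bool) :
    treat (Function.update z k a) i = treat z i := by
  simp [treat, h]

lemma treat_eq_zero_or_one (z : Fin N → Bool) (i : Fin N) : treat z i = 0 ∨ treat z i = 1 := by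
  unfold treat; split_ifs <;> simp

/-- The marginalized response under arm `a`, averaged over the units. -/
noncomputable def armMean (N : ℕ) (p : ℝ) (m : Fin N → (Fin N → Bool) → ℝ) (a : Bool) : ℝ :=
  (1 / N) * ∑ i, ∫ z, m i (Function.update z i a) ∂ bernPi N p

/-- The `i`-th summand of the linearization of the Hajek estimator. -/
noncomputable def linTerm (N : ℕ) (p : ℝ) (m : Fin N → (Fin N → Bool) → ℝ) (i : Fin N)
    (z : Fin N → Bool) : ℝ :=
  treat z i * (m i z - armMean N p m true) / p
    - (1 - treat z i) * (m i z - armMean N p m false) / (1 - p)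

/-- The linearization of the Hajek estimator. -/
noncomputable def hajekLin (N : ℕ) (p : ℝ) (m : Fin N → (Fin N → Bool) → ℝ)
    (z : Fin N → Bool) : ℝ :=
  (∑ i, linTerm N p m i z) / N

lemma amr_eq (m : Fin N → (Fin N → Bool) → ℝ) :
    amr N p m = armMean N p m true - armMean N p m false := by
  simp only [amr, armMean, Finset.sum_sub_distrib, mul_sub]

lemma integral_treat_mul (h0 : 0 ≤ p) (h1 : p ≤ 1) (F : (Fin N → Bool) → ℝ) (i : Fin N) :
    ∫ z, treat z i * F z ∂ bernPi N p = p * ∫ z, F (Function.update z i true) ∂ bernPi N p := by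
  rw [integral_bernPi_update h0 h1 _ i]
  simp [treat_update_self]

lemma integral_one_sub_treat_mul (h0 : 0 ≤ p) (h1 : p ≤ 1) (F : (Fin N → Bool) → ℝ) (i : Fin N) :
    ∫ z, (1 - treat z i) * F z ∂ bernPi N p =
      (1 - p) * ∫ z, F (Function.update z i false) ∂ bernPi N p := by
  rw [integral_bernPi_update h0 h1 _ i]
  simp [treat_update_self]

lemma abs_armMean_le (h0 : 0 ≤ p) (h1 : p ≤ 1) (hN : 0 < N) {m : Fin N → (Fin N → Bool) → ℝ}
    (hm : ∀ i z, |m i z| ≤ b) (a : Bool) : |armMean N p m a| ≤ b := by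
  have := isProbabilityMeasure_bernPi N h0 h1
  have hN' : (0 : ℝ) < N := by exact_mod_cast hN
  rw [armMean, abs_mul, abs_of_pos (by positivity : (0 : ℝ) < 1 / N), one_div,
    inv_mul_le_iff₀ hN']
  refine (Finset.abs_sum_le_sum_abs _ _).trans
    ((Finset.sum_le_sum (g := fun _ => b) fun i _ => ?_).trans_eq (by simp))
  simpa using norm_integral_le_of_norm_le_const (μ := bernPi N p)
    (f := fun z => m i (Function.update z i a)) (ae_of_all _ fun z => hm i (Function.update z i a))

section Means

variable (m : Fin N → (Fin N → Bool) → ℝ)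

lemma sum_integral_treated (h0 : 0 ≤ p) (h1 : p ≤ 1) (hN : 0 < N) :
    ∫ z, ∑ i, treat z i * (m i z - armMean N p m true) ∂ bernPi N p = 0 := by
  have := isProbabilityMeasure_bernPi N h0 h1
  have hN' : (N : ℝ) ≠ 0 := by exact_mod_cast hN.ne'
  rw [integral_finsetSum _ fun i _ => integrable_bernPi _]
  simp only [integral_treat_mul h0 h1, integral_sub (integrable_bernPi _) (integrable_bernPi _)]
  rw [← Finset.mul_sum, Finset.sum_sub_distrib]
  simp [armMean, hN']

lemma sum_integral_control (h0 : 0 ≤ p) (h1 : p ≤ 1) (hN : 0 < N) :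
    ∫ z, ∑ i, (1 - treat z i) * (m i z - armMean N p m false) ∂ bernPi N p = 0 := by
  have := isProbabilityMeasure_bernPi N h0 h1
  have hN' : (N : ℝ) ≠ 0 := by exact_mod_cast hN.ne'
  rw [integral_finsetSum _ fun i _ => integrable_bernPi _]
  simp only [integral_one_sub_treat_mul h0 h1,
    integral_sub (integrable_bernPi _) (integrable_bernPi _)]
  rw [← Finset.mul_sum, Finset.sum_sub_distrib]
  simp [armMean, hN']

lemma sum_integral_treat_sub (h0 : 0 ≤ p) (h1 : p ≤ 1) :
    ∫ z, ∑ i, (treat z i - p) ∂ bernPi N p = 0 := by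
  have := isProbabilityMeasure_bernPi N h0 h1
  rw [integral_finsetSum _ fun i _ => integrable_bernPi _]
  refine Finset.sum_eq_zero fun i _ => ?_
  have := integral_treat_mul h0 h1 (fun _ => 1) i
  rw [integral_sub (integrable_bernPi _) (integrable_bernPi _)]
  simpa [sub_eq_zero] using this

lemma hajekLin_eq (z : Fin N → Bool) :
    hajekLin N p m z = ((∑ i, treat z i * (m i z - armMean N p m true)) / N) / p
      - ((∑ i, (1 - treat z i) * (m i z - armMean N p m false)) / N) / (1 - p) := by
  simp only [hajekLin, linTerm, Finset.sum_sub_distrib, ← Finset.sum_div]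
  ring

lemma integral_hajekLin (h0 : 0 ≤ p) (h1 : p ≤ 1) (hN : 0 < N) :
    ∫ z, hajekLin N p m z ∂ bernPi N p = 0 := by
  simp only [hajekLin_eq]
  rw [integral_sub (integrable_bernPi _) (integrable_bernPi _), integral_div, integral_div,
    integral_div, integral_div, sum_integral_treated m h0 h1 hN, sum_integral_control m h0 h1 hN]
  simp

end Means

lemma card_treated_eq (z : Fin N → Bool) :
    (((Finset.univ.filter fun i => z i = true).card : ℕ) : ℝ) = ∑ i, treat z i := by
  simp [treat]

lemma tauHatHA_eq (m : Fin N → (Fin N → Bool) → ℝ) (hN : 0 < N) (z : Fin N → Bool)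
    (hq0 : (∑ i, treat z i) / N ≠ 0) (hq1 : (∑ i, treat z i) / N ≠ 1) :
    tauHatHA N m z = ((∑ i, treat z i * m i z) / N) / ((∑ i, treat z i) / N)
      - ((∑ i, (1 - treat z i) * m i z) / N) / (1 - (∑ i, treat z i) / N) := by
  have hN' : (N : ℝ) ≠ 0 := by exact_mod_cast hN.ne'
  have hle : (Finset.univ.filter fun i => z i = true).card ≤ N :=
    (Finset.card_le_univ _).trans_eq (by simp)
  have hc := card_treated_eq z
  rw [tauHatHA, if_neg, Nat.cast_sub hle, hc]
  · have hs : ∑ i, treat z i ≠ 0 := fun h => hq0 (by simp [h])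
    have hs1 : (N : ℝ) - ∑ i, treat z i ≠ 0 := fun h => hq1 (by
      rw [← sub_eq_zero.1 h, div_self hN'])
    have e : 1 - (∑ i, treat z i) / N = (N - ∑ i, treat z i) / N := by field_simp
    rw [e, div_div_div_cancel_right₀ hN', div_div_div_cancel_right₀ hN']
    simp only [treat]
    ring
  · rintro (h | h)
    · rw [h] at hc; exact hq0 (by rw [← hc]; simp)
    · rw [h] at hc; exact hq1 (by rw [← hc, div_self hN'])

lemma abs_tauHatHA_le {m : Fin N → (Fin N → Bool) → ℝ} (hb : 0 ≤ b)
    (hm : ∀ i z, |m i z| ≤ b) (z : Fin N → Bool) : |tauHatHA N m z| ≤ 2 * b := by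
  have hle : (Finset.univ.filter fun i => z i = true).card ≤ N :=
    (Finset.card_le_univ _).trans_eq (by simp)
  have hc := card_treated_eq z
  rw [tauHatHA]
  split_ifs with h
  · simpa using hb
  push Not at h
  rw [Nat.cast_sub hle, hc]
  have hpos : 0 < ∑ i, treat z i := by
    rw [← hc]; exact_mod_cast Nat.pos_of_ne_zero h.1
  have hpos' : 0 < (N : ℝ) - ∑ i, treat z i := by
    rw [← hc, sub_pos]; exact_mod_cast lt_of_le_of_ne hle h.2
  have h1 : |1 / (∑ i, treat z i) * ∑ i, treat z i * m i z| ≤ b := by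
    rw [abs_mul, abs_of_pos (by positivity), one_div, inv_mul_le_iff₀ hpos, Finset.sum_mul]
    refine (Finset.abs_sum_le_sum_abs _ _).trans (Finset.sum_le_sum fun i _ => ?_)
    rcases treat_eq_zero_or_one z i with e | e <;> simp [e, hm]
  have h2 : |1 / (N - ∑ i, treat z i) * ∑ i, (1 - treat z i) * m i z| ≤ b := by
    have e : (N : ℝ) - ∑ i, treat z i = ∑ i, (1 - treat z i) := by simp
    rw [abs_mul, abs_of_pos (by positivity), one_div, inv_mul_le_iff₀ hpos', e, Finset.sum_mul]
    refine (Finset.abs_sum_le_sum_abs _ _).trans (Finset.sum_le_sum fun i _ => ?_)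
    rcases treat_eq_zero_or_one z i with e | e <;> simp [e, hm]
  calc _ ≤ _ := abs_sub _ _
    _ ≤ b + b := add_le_add h1 h2
    _ = 2 * b := by ring

/-- The elementary estimate behind the linearization of a difference of ratios. -/
lemma sq_ratio_error_le {p q d x y r A : ℝ} (hd : 0 < d) (hdp : d ≤ p) (hdp' : d ≤ 1 - p)
    (hr : |r| ≤ A)
    (hreq : q ≠ 0 → q ≠ 1 → r = x * (1 / q - 1 / p) - y * (1 / (1 - q) - 1 / (1 - p))) :
    r ^ 2 ≤ (8 / d ^ 4 + 16 * A ^ 2 / d ^ 4) * (x ^ 4 + y ^ 4 + (q - p) ^ 4) := by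
  have hA : 0 ≤ A := (abs_nonneg _).trans hr
  rw [add_mul]
  have nn : 0 ≤ x ^ 4 + y ^ 4 + (q - p) ^ 4 := by positivity
  rcases le_or_gt |q - p| (d / 2) with h | h
  · refine le_add_of_le_of_nonneg ?_ (by positivity)
    rw [abs_le] at h
    have hq : d / 2 ≤ q := by linarith
    have hq' : d / 2 ≤ 1 - q := by linarith
    have hq0 : 0 < q := by linarith
    have hq1 : 0 < 1 - q := by linarith
    have hp0 : 0 < p := by linarith
    have hp1 : 0 < 1 - p := by linarith
    have e := hreq hq0.ne' (by linarith)
    have e1 : 1 / q - 1 / p = -((q - p) * (1 / (q * p))) := by field_simp; ring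
    have e2 : 1 / (1 - q) - 1 / (1 - p) = (q - p) * (1 / ((1 - q) * (1 - p))) := by
      field_simp; ring
    have b1 : 1 / (q * p) ≤ 2 / d ^ 2 := by
      rw [div_le_div_iff₀ (by positivity) (by positivity)]; nlinarith
    have b2 : 1 / ((1 - q) * (1 - p)) ≤ 2 / d ^ 2 := by
      rw [div_le_div_iff₀ (by positivity) (by positivity)]; nlinarith
    have a1 : (x * (1 / q - 1 / p)) ^ 2 ≤ x ^ 2 * (q - p) ^ 2 * (2 / d ^ 2) ^ 2 := by
      rw [e1]
      calc _ = x ^ 2 * (q - p) ^ 2 * (1 / (q * p)) ^ 2 := by ring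
        _ ≤ _ := by gcongr
    have a2 : (y * (1 / (1 - q) - 1 / (1 - p))) ^ 2 ≤ y ^ 2 * (q - p) ^ 2 * (2 / d ^ 2) ^ 2 := by
      rw [e2]
      calc _ = y ^ 2 * (q - p) ^ 2 * (1 / ((1 - q) * (1 - p))) ^ 2 := by ring
        _ ≤ _ := by gcongr
    have a3 : x ^ 2 * (q - p) ^ 2 + y ^ 2 * (q - p) ^ 2 ≤ x ^ 4 + y ^ 4 + (q - p) ^ 4 := by
      nlinarith [sq_nonneg (x ^ 2 - (q - p) ^ 2), sq_nonneg (y ^ 2 - (q - p) ^ 2),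
        sq_nonneg (x ^ 2), sq_nonneg (y ^ 2)]
    calc r ^ 2 ≤ 2 * ((x * (1 / q - 1 / p)) ^ 2 + (y * (1 / (1 - q) - 1 / (1 - p))) ^ 2) := by
          rw [e]
          nlinarith [sq_nonneg (x * (1 / q - 1 / p) + y * (1 / (1 - q) - 1 / (1 - p)))]
      _ ≤ 2 * ((2 / d ^ 2) ^ 2 * (x ^ 2 * (q - p) ^ 2 + y ^ 2 * (q - p) ^ 2)) := by linarith
      _ ≤ 2 * ((2 / d ^ 2) ^ 2 * (x ^ 4 + y ^ 4 + (q - p) ^ 4)) := by gcongr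
      _ = _ := by ring
  · refine le_add_of_nonneg_of_le (by positivity) ?_
    have h4 : (d / 2) ^ 4 ≤ (q - p) ^ 4 := by
      rw [← (by decide : Even 4).pow_abs (q - p)]; gcongr
    have hx : (d / 2) ^ 4 ≤ x ^ 4 + y ^ 4 + (q - p) ^ 4 := h4.trans (by
      linarith [(by positivity : 0 ≤ x ^ 4 + y ^ 4)])
    calc r ^ 2 ≤ A ^ 2 := sq_le_sq' (by linarith [(abs_le.1 hr).1]) (abs_le.1 hr).2
      _ = 16 * A ^ 2 / d ^ 4 * (d / 2) ^ 4 := by field_simp; norm_num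
      _ ≤ _ := by gcongr

end Hajek

section Remainder

variable {N : ℕ} {p b d : ℝ} {c : ℕ} {S : Fin N → Finset (Fin N)}
  {m : Fin N → (Fin N → Bool) → ℝ}

lemma fourth_moment_average_le (h0 : 0 ≤ p) (h1 : p ≤ 1) (hN : 0 < N)
    {X : Fin N → (Fin N → Bool) → ℝ} {K : ℝ} (hX : ∀ i z, |X i z| ≤ K)
    (hcard : ∀ i, (S i).card ≤ c)
    (hdep : ∀ k, ∀ i ∉ S k, ∀ z a, X i (Function.update z k a) = X i z)
    (hmean : ∫ z, ∑ i, X i z ∂ bernPi N p = 0) :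
    ∫ z, ((∑ i, X i z) / N) ^ 4 ∂ bernPi N p ≤ 17 * (c * (2 * K)) ^ 4 / N ^ 2 := by
  have hN' : (0 : ℝ) < N := by exact_mod_cast hN
  have h := fourth_moment_le_of_bounded_differences h0 h1 (abs_sum_update_sub_le hX S hcard hdep)
    hmean
  simp only [div_pow]
  rw [integral_div, div_le_iff₀ (by positivity)]
  refine h.trans_eq ?_
  field_simp

lemma abs_centered_treated_le (hm : ∀ i z, |m i z| ≤ b) {M : ℝ} (hM : |M| ≤ b) (i : Fin N)
    (z : Fin N → Bool) : |treat z i * (m i z - M)| ≤ 2 * b := by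
  have hb : 0 ≤ b := (abs_nonneg _).trans hM
  have := (abs_sub (m i z) M).trans (add_le_add (hm i z) hM)
  rcases treat_eq_zero_or_one z i with e | e <;> rw [e]
  · simpa using hb
  · rw [one_mul]; linarith

lemma abs_centered_control_le (hm : ∀ i z, |m i z| ≤ b) {M : ℝ} (hM : |M| ≤ b) (i : Fin N)
    (z : Fin N → Bool) : |(1 - treat z i) * (m i z - M)| ≤ 2 * b := by
  have hb : 0 ≤ b := (abs_nonneg _).trans hM
  have := (abs_sub (m i z) M).trans (add_le_add (hm i z) hM)
  rcases treat_eq_zero_or_one z i with e | e <;> rw [e]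
  · rw [sub_zero, one_mul]; linarith
  · simpa using hb

lemma abs_linTerm_le (hd : 0 < d) (hdp : d ≤ p) (hdp' : d ≤ 1 - p) (hN : 0 < N)
    (hm : ∀ i z, |m i z| ≤ b) (i : Fin N) (z : Fin N → Bool) :
    |linTerm N p m i z| ≤ 2 * b / d := by
  have h0 : 0 < p := by linarith
  have h1 : 0 < 1 - p := by linarith
  have hb : 0 ≤ b := (abs_nonneg _).trans (hm i z)
  have hM a := abs_armMean_le h0.le (by linarith) hN hm a
  have t (a) := (abs_sub (m i z) (armMean N p m a)).trans (add_le_add (hm i z) (hM a))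
  rw [linTerm]
  rcases treat_eq_zero_or_one z i with e | e <;> rw [e]
  · rw [zero_mul, zero_div, zero_sub, abs_neg, sub_zero, one_mul, abs_div, abs_of_pos h1]
    gcongr
    linarith [t false]
  · rw [sub_self, zero_mul, zero_div, sub_zero, one_mul, abs_div, abs_of_pos h0]
    gcongr
    linarith [t true]

lemma linTerm_update (hrefl : ∀ i, i ∈ S i)
    (hdep : ∀ k, ∀ i ∉ S k, ∀ z a, m i (Function.update z k a) = m i z) :
    ∀ k, ∀ i ∉ S k, ∀ z a, linTerm N p m i (Function.update z k a) = linTerm N p m i z := by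
  intro k i hi z a
  have hik : i ≠ k := fun h => hi (h ▸ hrefl i)
  simp only [linTerm, hdep k i hi, treat_update_of_ne hik]

lemma abs_hajekLin_le (hd : 0 < d) (hdp : d ≤ p) (hdp' : d ≤ 1 - p) (hN : 0 < N)
    (hm : ∀ i z, |m i z| ≤ b) (z : Fin N → Bool) : |hajekLin N p m z| ≤ 2 * b / d := by
  have hN' : (0 : ℝ) < N := by exact_mod_cast hN
  rw [hajekLin, abs_div, abs_of_pos hN', div_le_iff₀ hN']
  refine (Finset.abs_sum_le_sum_abs _ _).trans
    ((Finset.sum_le_sum fun i _ => abs_linTerm_le hd hdp hdp' hN hm i z).trans_eq ?_)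
  simp [mul_comm]

/-- The squared error of the linearization of the Hajek estimator is of order `N⁻²`. -/
lemma integral_sq_hajek_remainder_le (hd : 0 < d) (hdp : d ≤ p) (hdp' : d ≤ 1 - p) (hb : 0 ≤ b)
    (hN : 0 < N) (hrefl : ∀ i, i ∈ S i) (hcard : ∀ i, (S i).card ≤ c)
    (hm : ∀ i z, |m i z| ≤ b)
    (hdep : ∀ k, ∀ i ∉ S k, ∀ z a, m i (Function.update z k a) = m i z) :
    ∫ z, (tauHatHA N m z - amr N p m - hajekLin N p m z) ^ 2 ∂ bernPi N p ≤
      (8 / d ^ 4 + 16 * (4 * b + 2 * b / d) ^ 2 / d ^ 4) *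
        (3 * (17 * (c * (2 * (2 * b + 1))) ^ 4)) / N ^ 2 := by
  have h0 : 0 ≤ p := by linarith
  have h1 : p ≤ 1 := by linarith
  have hN' : (N : ℝ) ≠ 0 := by exact_mod_cast hN.ne'
  have hM a := abs_armMean_le h0 h1 hN hm a
  have hne : ∀ {k i}, i ∉ S k → i ≠ k := fun {k i} hi h => hi (h ▸ hrefl i)
  have e1 := fourth_moment_average_le h0 h1 hN (K := 2 * b + 1)
    (X := fun i z => treat z i * (m i z - armMean N p m true))
    (fun i z => (abs_centered_treated_le hm (hM true) i z).trans (by linarith)) hcard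
    (fun k i hi z a => by rw [hdep k i hi, treat_update_of_ne (hne hi)])
    (sum_integral_treated m h0 h1 hN)
  have e0 := fourth_moment_average_le h0 h1 hN (K := 2 * b + 1)
    (X := fun i z => (1 - treat z i) * (m i z - armMean N p m false))
    (fun i z => (abs_centered_control_le hm (hM false) i z).trans (by linarith)) hcard
    (fun k i hi z a => by rw [hdep k i hi, treat_update_of_ne (hne hi)])
    (sum_integral_control m h0 h1 hN)
  have eq := fourth_moment_average_le h0 h1 hN (K := 2 * b + 1)
    (X := fun i z => treat z i - p)
    (fun i z => by
      rcases treat_eq_zero_or_one z i with e | e <;> rw [e, abs_le] <;> constructor <;> linarith)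
    hcard (fun k i hi z a => by rw [treat_update_of_ne (hne hi)])
    (sum_integral_treat_sub h0 h1)
  set C := 8 / d ^ 4 + 16 * (4 * b + 2 * b / d) ^ 2 / d ^ 4 with hC
  have hC0 : 0 ≤ C := by positivity
  calc _ ≤ ∫ z, C * (((∑ i, treat z i * (m i z - armMean N p m true)) / N) ^ 4
        + ((∑ i, (1 - treat z i) * (m i z - armMean N p m false)) / N) ^ 4
        + ((∑ i, (treat z i - p)) / N) ^ 4) ∂ bernPi N p := by
        refine integral_bernPi_mono fun z => ?_
        have hq : (∑ i, (treat z i - p)) / N = (∑ i, treat z i) / N - p := by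
          rw [Finset.sum_sub_distrib, sub_div]; simp [hN']
        rw [hq]
        refine sq_ratio_error_le hd hdp hdp' ?_ fun hq0 hq1 => ?_
        · have t1 := abs_tauHatHA_le (N := N) hb hm z
          have t2 := abs_hajekLin_le hd hdp hdp' hN hm z
          have t3 := hM true
          have t4 := hM false
          rw [amr_eq]
          rw [abs_le] at *
          constructor <;> linarith
        · rw [tauHatHA_eq m hN z hq0 hq1, hajekLin_eq, amr_eq]
          have f1 : (∑ i, treat z i * (m i z - armMean N p m true)) / N =
              (∑ i, treat z i * m i z) / N - (∑ i, treat z i) / N * armMean N p m true := by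
            simp only [mul_sub, Finset.sum_sub_distrib, ← Finset.sum_mul]; ring
          have f0 : (∑ i, (1 - treat z i) * (m i z - armMean N p m false)) / N =
              (∑ i, (1 - treat z i) * m i z) / N
                - (1 - (∑ i, treat z i) / N) * armMean N p m false := by
            simp only [mul_sub, Finset.sum_sub_distrib, ← Finset.sum_mul]
            simp only [Finset.sum_const, Finset.card_univ, Fintype.card_fin, nsmul_eq_mul]
            field_simp
          rw [f1, f0]
          have hq1' : 1 - (∑ i, treat z i) / N ≠ 0 := sub_ne_zero.2 hq1.symm
          generalize (∑ i, treat z i) / (N : ℝ) = q at *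
          field_simp
          ring
    _ ≤ C * (17 * (c * (2 * (2 * b + 1))) ^ 4 / N ^ 2 + 17 * (c * (2 * (2 * b + 1))) ^ 4 / N ^ 2
        + 17 * (c * (2 * (2 * b + 1))) ^ 4 / N ^ 2) := by
        rw [integral_const_mul, integral_add (integrable_bernPi _) (integrable_bernPi _),
          integral_add (integrable_bernPi _) (integrable_bernPi _)]
        gcongr
    _ = _ := by ring

end Remainder

section Asymptotics

variable {N : ℕ} {p b d : ℝ} {c : ℕ} {S : Fin N → Finset (Fin N)}
  {m : Fin N → (Fin N → Bool) → ℝ}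

lemma integral_sq_hajekLin_le (hd : 0 < d) (hdp : d ≤ p) (hdp' : d ≤ 1 - p)
    (hN : 0 < N) (hrefl : ∀ i, i ∈ S i) (hcard : ∀ i, (S i).card ≤ c)
    (hm : ∀ i z, |m i z| ≤ b)
    (hdep : ∀ k, ∀ i ∉ S k, ∀ z a, m i (Function.update z k a) = m i z) :
    N * ∫ z, hajekLin N p m z ^ 2 ∂ bernPi N p ≤ (c * (2 * (2 * b / d))) ^ 2 := by
  have h0 : 0 ≤ p := by linarith
  have h1 : p ≤ 1 := by linarith
  have hN' : (0 : ℝ) < N := by exact_mod_cast hN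
  have hdiff := abs_sum_update_sub_le (abs_linTerm_le hd hdp hdp' hN hm) S hcard
    (linTerm_update (p := p) hrefl hdep)
  have h := variance_le_of_bounded_differences h0 h1 (F := hajekLin N p m)
    (D := c * (2 * (2 * b / d)) / N) fun k z a => by
      rw [hajekLin, hajekLin, ← sub_div, abs_div, abs_of_pos hN']
      gcongr
      exact hdiff k z a
  rw [integral_hajekLin m h0 h1 hN] at h
  calc _ ≤ (N : ℝ) * (N * (c * (2 * (2 * b / d)) / N) ^ 2) := by
        gcongr; simpa using h
    _ = _ := by field_simp

lemma norm_charFun_hajekLin_sub_le (hd : 0 < d) (hdp : d ≤ p) (hdp' : d ≤ 1 - p) (hb : 0 ≤ b)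
    (hN : 0 < N) (hrefl : ∀ i, i ∈ S i) (hsymm : ∀ i j, i ∈ S j → j ∈ S i)
    (hcard : ∀ i, (S i).card ≤ c) (hm : ∀ i z, |m i z| ≤ b)
    (hdep : ∀ k, ∀ i ∉ S k, ∀ z a, m i (Function.update z k a) = m i z) (t : ℝ) :
    ‖(∫ z, Complex.exp ((t * (√N * hajekLin N p m z) : ℝ) * Complex.I) ∂ bernPi N p)
        - Complex.exp ((-((N * ∫ z, hajekLin N p m z ^ 2 ∂ bernPi N p) * t ^ 2 / 2) : ℝ))‖
      ≤ ((|t| * (2 * c ^ 5 * (4 * b / d) ^ 2) + 3 * c ^ 4 * (4 * b / d) ^ 3 * t ^ 2) * |t|) / √N := by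
  have h0 : 0 ≤ p := by linarith
  have h1 : p ≤ 1 := by linarith
  have := isProbabilityMeasure_bernPi N h0 h1
  have hN' : (0 : ℝ) < N := by exact_mod_cast hN
  have hs : 0 < √(N : ℝ) := Real.sqrt_pos.2 hN'
  have hs2 : √(N : ℝ) ^ 2 = N := Real.sq_sqrt hN'.le
  let X : Fin N → (Fin N → Bool) → ℝ := fun i z =>
    (linTerm N p m i z - ∫ w, linTerm N p m i w ∂ bernPi N p) / √N
  have hlin := abs_linTerm_le hd hdp hdp' hN hm
  have hmean0 : ∑ i, ∫ w, linTerm N p m i w ∂ bernPi N p = 0 := by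
    have := integral_hajekLin m h0 h1 hN
    simp only [hajekLin] at this
    rw [integral_div, div_eq_zero_iff, integral_finsetSum _ fun i _ => integrable_bernPi _] at this
    exact this.resolve_right hN'.ne'
  have hsum : ∀ z, ∑ i, X i z = √N * hajekLin N p m z := by
    intro z
    simp only [X]
    rw [← Finset.sum_div, Finset.sum_sub_distrib, hmean0, sub_zero, hajekLin]
    rw [div_eq_iff hs.ne']
    calc _ = √(N : ℝ) ^ 2 * ((∑ i, linTerm N p m i z) / N) := by rw [hs2]; field_simp
      _ = _ := by ring
  have hX : ∀ i z, |X i z| ≤ 4 * b / d / √N := by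
    intro i z
    have hi : |∫ w, linTerm N p m i w ∂ bernPi N p| ≤ 2 * b / d := by
      simpa using norm_integral_le_of_norm_le_const (μ := bernPi N p)
        (f := linTerm N p m i) (ae_of_all _ fun z => hlin i z)
    simp only [X]
    rw [abs_div, abs_of_pos hs]
    gcongr
    calc _ ≤ 2 * b / d + 2 * b / d := (abs_sub _ _).trans (add_le_add (hlin i z) hi)
      _ = _ := by ring
  have key := norm_charFun_sum_sub_le h0 h1 hrefl hsymm hcard (by positivity) hX
    (fun k i hi z a => by simp only [X, linTerm_update hrefl hdep k i hi])
    (fun i => by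
      simp only [X]
      rw [integral_div, integral_sub (integrable_bernPi _) (integrable_bernPi _)]
      simp) t
  simp only [hsum, mul_pow, hs2, integral_const_mul] at key
  refine key.trans_eq ?_
  have hs3 : √(N : ℝ) ^ 3 = N * √N := by rw [pow_succ, hs2]
  rw [div_pow, div_pow _ (√(N : ℝ)), hs2, hs3]
  have hNs : (N : ℝ) = √N * √N := by rw [← pow_two, hs2]
  field_simp
  rw [hs2]
  ring

lemma abs_variance_sub_le {N : ℕ} {p : ℝ} (h0 : 0 ≤ p) (h1 : p ≤ 1) (hN : 0 < N)
    {τ L : (Fin N → Bool) → ℝ} {a C₁ C₂ : ℝ} (hL0 : ∫ z, L z ∂ bernPi N p = 0)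
    (hL : N * ∫ z, L z ^ 2 ∂ bernPi N p ≤ C₁)
    (hr : ∫ z, (τ z - a - L z) ^ 2 ∂ bernPi N p ≤ C₂ / N ^ 2) :
    |N * variance τ (bernPi N p) - N * ∫ z, L z ^ 2 ∂ bernPi N p| ≤ (C₁ + 2 * C₂) / √N := by
  have := isProbabilityMeasure_bernPi N h0 h1
  have hN' : (0 : ℝ) < N := by exact_mod_cast hN
  have hs : 0 < √(N : ℝ) := Real.sqrt_pos.2 hN'
  have hs2 : √(N : ℝ) ^ 2 = N := Real.sq_sqrt hN'.le
  set ρ : (Fin N → Bool) → ℝ := fun z => τ z - a - L z with hρ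
  have hτ : τ = fun z => (L z + ρ z) + a := by ext z; simp [hρ]
  have hvar : variance τ (bernPi N p) = ∫ z, L z ^ 2 ∂ bernPi N p
      + ∫ z, 2 * L z * ρ z ∂ bernPi N p + ∫ z, ρ z ^ 2 ∂ bernPi N p
      - (∫ z, ρ z ∂ bernPi N p) ^ 2 := by
    rw [hτ, variance_add_const (by fun_prop), variance_eq_sub .of_discrete,
      integral_add (integrable_bernPi _) (integrable_bernPi _), hL0, zero_add,
      ← integral_add (integrable_bernPi _) (integrable_bernPi _),
      ← integral_add (integrable_bernPi _) (integrable_bernPi _)]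
    congr 2
    ext z
    simp only [Pi.pow_apply]
    ring
  have hcross : |∫ z, 2 * L z * ρ z ∂ bernPi N p| ≤
      (∫ z, L z ^ 2 ∂ bernPi N p) / √N + √N * ∫ z, ρ z ^ 2 ∂ bernPi N p := by
    rw [← integral_div, ← integral_const_mul,
      ← integral_add (integrable_bernPi _) (integrable_bernPi _)]
    refine (abs_integral_le_integral_abs).trans (integral_bernPi_mono fun z => ?_)
    have e1 : 0 ≤ (L z + √N * ρ z) ^ 2 / √N := by positivity
    have e2 : 0 ≤ (L z - √N * ρ z) ^ 2 / √N := by positivity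
    have e3 : (L z + √N * ρ z) ^ 2 / √N = L z ^ 2 / √N + √N * ρ z ^ 2 + 2 * L z * ρ z := by
      field_simp; ring
    have e4 : (L z - √N * ρ z) ^ 2 / √N = L z ^ 2 / √N + √N * ρ z ^ 2 - 2 * L z * ρ z := by
      field_simp; ring
    rw [abs_le]
    constructor <;> linarith
  have hsq := sq_integral_le h0 h1 ρ
  have hρ0 : 0 ≤ ∫ z, ρ z ^ 2 ∂ bernPi N p := integral_nonneg fun z => sq_nonneg _
  have hs1 : 1 ≤ √(N : ℝ) := Real.one_le_sqrt.2 (by exact_mod_cast hN)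
  have hr' : √(N : ℝ) * (N * ∫ z, ρ z ^ 2 ∂ bernPi N p) ≤ C₂ / √N := by
    calc _ ≤ √(N : ℝ) * (N * (C₂ / N ^ 2)) := by gcongr
      _ = (√(N : ℝ) ^ 2 * C₂) / (N * √N) := by field_simp
      _ = _ := by rw [hs2]; field_simp
  have hL' : N * ((∫ z, L z ^ 2 ∂ bernPi N p) / √N) ≤ C₁ / √N := by
    rw [← mul_div_assoc]; gcongr
  have hNρ : N * ∫ z, ρ z ^ 2 ∂ bernPi N p ≤ √(N : ℝ) * (N * ∫ z, ρ z ^ 2 ∂ bernPi N p) :=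
    le_mul_of_one_le_left (by positivity) hs1
  have hNsq : N * (∫ z, ρ z ∂ bernPi N p) ^ 2 ≤ N * ∫ z, ρ z ^ 2 ∂ bernPi N p := by gcongr
  have hNsq0 : 0 ≤ N * (∫ z, ρ z ∂ bernPi N p) ^ 2 := by positivity
  have hNc : N * |∫ z, 2 * L z * ρ z ∂ bernPi N p| ≤ N * _ :=
    mul_le_mul_of_nonneg_left hcross hN'.le
  have hc1 := mul_le_mul_of_nonneg_left (neg_abs_le (∫ z, 2 * L z * ρ z ∂ bernPi N p)) hN'.le
  have hc2 := mul_le_mul_of_nonneg_left (le_abs_self (∫ z, 2 * L z * ρ z ∂ bernPi N p)) hN'.le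
  rw [hvar, add_div, mul_div_assoc, abs_le]
  have hass : N * (√(N : ℝ) * ∫ z, ρ z ^ 2 ∂ bernPi N p) =
      √(N : ℝ) * (N * ∫ z, ρ z ^ 2 ∂ bernPi N p) := by ring
  rw [mul_add, hass] at hNc
  constructor <;> linarith

lemma norm_charFun_sub_charFun_le {N : ℕ} {p : ℝ} (h0 : 0 ≤ p) (h1 : p ≤ 1) (hN : 0 < N)
    {T L : (Fin N → Bool) → ℝ} {C : ℝ}
    (hr : ∫ z, (T z - L z) ^ 2 ∂ bernPi N p ≤ C / N ^ 2) (t : ℝ) :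
    ‖(∫ z, Complex.exp ((t * (√N * T z) : ℝ) * Complex.I) ∂ bernPi N p)
        - ∫ z, Complex.exp ((t * (√N * L z) : ℝ) * Complex.I) ∂ bernPi N p‖ ≤
      |t| * √C / √N := by
  have hN' : (0 : ℝ) < N := by exact_mod_cast hN
  have hs : 0 < √(N : ℝ) := Real.sqrt_pos.2 hN'
  have hs2 : √(N : ℝ) ^ 2 = N := Real.sq_sqrt hN'.le
  have habs : ∫ z, |T z - L z| ∂ bernPi N p ≤ √C / N := by
    have h := sq_integral_le h0 h1 fun z => |T z - L z|
    simp only [sq_abs] at h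
    have := Real.le_sqrt_of_sq_le (h.trans hr)
    rwa [Real.sqrt_div' _ (by positivity), Real.sqrt_sq hN'.le] at this
  rw [← integral_sub (integrable_bernPi _) (integrable_bernPi _)]
  refine (norm_integral_bernPi_le (G := fun z => |t| * √N * |T z - L z|) fun z => ?_).trans ?_
  · have e : Complex.exp ((t * (√N * T z) : ℝ) * Complex.I)
        - Complex.exp ((t * (√N * L z) : ℝ) * Complex.I) =
        Complex.exp ((t * (√N * L z) : ℝ) * Complex.I) *
          (Complex.exp (Complex.I * (t * (√N * (T z - L z)) : ℝ)) - 1) := by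
      rw [mul_sub, ← Complex.exp_add, mul_one]; congr 2; push_cast; ring
    rw [e, norm_mul, Complex.norm_exp_ofReal_mul_I, one_mul]
    refine Real.norm_exp_I_mul_ofReal_sub_one_le.trans_eq ?_
    rw [Real.norm_eq_abs, abs_mul, abs_mul, abs_of_pos hs, mul_assoc]
  · rw [integral_const_mul]
    calc _ ≤ |t| * √N * (√C / N) := by gcongr
      _ = |t| * √N * (√C / √N ^ 2) := by rw [hs2]
      _ = _ := by field_simp

lemma tendsto_const_div_sqrt_nat (C : ℝ) : Tendsto (fun N : ℕ => C / √N) atTop (𝓝 0) :=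
  (Real.tendsto_sqrt_atTop.comp tendsto_natCast_atTop_atTop).const_div_atTop C

/-- Convergence of characteristic functions on the discrete cubes yields weak convergence. -/
lemma tendsto_integral_of_tendsto_charFun {p : ℝ} (h0 : 0 ≤ p) (h1 : p ≤ 1)
    (T : (N : ℕ) → (Fin N → Bool) → ℝ) (v : NNReal)
    (h : ∀ t : ℝ, Tendsto (fun N => ∫ z, Complex.exp ((t * T N z : ℝ) * Complex.I) ∂ bernPi N p)
      atTop (𝓝 (Complex.exp ((-(v * t ^ 2 / 2) : ℝ)))))
    (f : BoundedContinuousFunction ℝ ℝ) :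
    Tendsto (fun N => ∫ z, f (T N z) ∂ bernPi N p) atTop (𝓝 (∫ x, f x ∂ gaussianReal 0 v)) := by
  have hpr N := isProbabilityMeasure_bernPi N h0 h1
  have hT N : AEMeasurable (T N) (bernPi N p) := (measurable_of_finite _).aemeasurable
  let P : ℕ → ProbabilityMeasure ℝ := fun N =>
    ⟨(bernPi N p).map (T N), Measure.isProbabilityMeasure_map (hT N)⟩
  let P₀ : ProbabilityMeasure ℝ := ⟨gaussianReal 0 v, inferInstance⟩
  have hP : Tendsto P atTop (𝓝 P₀) := by
    refine ProbabilityMeasure.tendsto_of_tendsto_charFun fun t => ?_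
    have e0 : charFun (P₀ : Measure ℝ) t = Complex.exp ((-(v * t ^ 2 / 2) : ℝ)) := by
      change charFun (gaussianReal 0 v) t = _
      rw [charFun_gaussianReal]; congr 1; push_cast; ring
    have e N : charFun (P N : Measure ℝ) t =
        ∫ z, Complex.exp ((t * T N z : ℝ) * Complex.I) ∂ bernPi N p := by
      change charFun ((bernPi N p).map (T N)) t = _
      rw [charFun_apply_real, integral_map (hT N) (by fun_prop)]
      simp
    simp only [e, e0]
    exact h t
  have := ProbabilityMeasure.tendsto_iff_forall_integral_tendsto.1 hP f
  refine this.congr fun N => ?_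
  exact integral_map (hT N) f.continuous.aestronglyMeasurable

end Asymptotics

/-- Asymptotic normality of the Hajek estimator (Proposition 3):
if `N·Var(τ̂_{HA,N}) → V_{HA} > 0`, then `√N (τ̂_{HA,N} − τ_N)` converges in distribution
to `N(0, V_{HA})` (weak convergence stated via bounded continuous test functions). -/
theorem hajek_asymptotic_normality
    (p : ℝ) (hp0 : 0 < p) (hp1 : p < 1) (b : ℝ) (hb : 0 < b) (ctil : ℕ)
    (μ : (N : ℕ) → Fin N → (Fin N → Bool) → ℝ)
    (B : (N : ℕ) → Fin N → Finset (Fin N))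
    (hbound : ∀ N (i : Fin N) (z : Fin N → Bool), |μ N i z| ≤ b)
    (hself : ∀ N (i : Fin N), i ∈ B N i)
    (hdep : ∀ N, ∀ i j : Fin N, j ∉ B N i →
      (∀ z, μ N i (Function.update z j false) = μ N i (Function.update z j true)) ∧
      (∀ z, μ N j (Function.update z i false) = μ N j (Function.update z i true)) ∧
      (∀ a c : Bool,
        (∫ z, (μ N i (Function.update z i a) * μ N j (Function.update z j c)) ∂ bernPi N p)
          - (∫ z, μ N i (Function.update z i a) ∂ bernPi N p)
            * (∫ z, μ N j (Function.update z j c) ∂ bernPi N p) = 0))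
    (hcard : ∀ N (i : Fin N), (B N i).card ≤ ctil)
    (hindep : ∀ N, ∀ i : Fin N,
      Indep (MeasurableSpace.comap (Ufun N p (μ N) i) inferInstance)
        (⨆ (j : Fin N) (_ : j ∉ B N i),
          MeasurableSpace.comap (Ufun N p (μ N) j) inferInstance)
        (bernPi N p))
    (VHA : ℝ) (hV : 0 < VHA)
    (hvar : Tendsto (fun N : ℕ => (N : ℝ) * variance (tauHatHA N (μ N)) (bernPi N p))
      atTop (𝓝 VHA)) :
    ∀ f : BoundedContinuousFunction ℝ ℝ,
      Tendsto (fun N : ℕ =>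
          ∫ z, f (Real.sqrt N * (tauHatHA N (μ N) z - amr N p (μ N))) ∂ bernPi N p)
        atTop (𝓝 (∫ x, f x ∂ gaussianReal 0 VHA.toNNReal)) := by
  have h0 := hp0.le
  have h1 := hp1.le
  let S : (N : ℕ) → Fin N → Finset (Fin N) := fun N i =>
    (B N i).filter fun k => i ∈ B N k
  have hrefl N i : i ∈ S N i := Finset.mem_filter.2 ⟨hself N i, hself N i⟩
  have hsymm N i j (h : i ∈ S N j) : j ∈ S N i :=
    Finset.mem_filter.2 (Finset.mem_filter.1 h).symm
  have hScard N i : (S N i).card ≤ ctil := (Finset.card_filter_le _ _).trans (hcard N i)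
  have hSdep N : ∀ k, ∀ i ∉ S N k, ∀ z a, μ N i (Function.update z k a) = μ N i z := by
    intro k i hi z a
    have hft : ∀ w, μ N i (Function.update w k false) = μ N i (Function.update w k true) := by
      by_cases hk : k ∈ B N i
      · exact (hdep N k i fun h => hi (Finset.mem_filter.2 ⟨h, hk⟩)).2.1
      · exact (hdep N i k hk).1
    have hall : ∀ a', μ N i (Function.update z k a') = μ N i (Function.update z k true) := by
      rintro (_ | _)
      exacts [hft z, rfl]
    rw [hall a, ← hall (z k), Function.update_eq_self]
  obtain ⟨d, hd, hdp, hdp'⟩ : ∃ d, 0 < d ∧ d ≤ p ∧ d ≤ 1 - p :=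
    ⟨min p (1 - p), lt_min hp0 (by linarith), min_le_left _ _, min_le_right _ _⟩
  have hρ (N : ℕ) (hN : 0 < N) := integral_sq_hajek_remainder_le hd hdp hdp' hb.le hN
    (hrefl N) (hScard N) (hbound N) (hSdep N)
  set C₂ := (8 / d ^ 4 + 16 * (4 * b + 2 * b / d) ^ 2 / d ^ 4) *
        (3 * (17 * (ctil * (2 * (2 * b + 1))) ^ 4))
  have hL (N : ℕ) (hN : 0 < N) := integral_sq_hajekLin_le hd hdp hdp' hN
    (hrefl N) (hScard N) (hbound N) (hSdep N)
  have hvarL : Tendsto (fun N : ℕ => N * ∫ z, hajekLin N p (μ N) z ^ 2 ∂ bernPi N p) atTop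
      (𝓝 VHA) := by
    have hz := squeeze_zero_norm' (f := fun N : ℕ => N * variance (tauHatHA N (μ N)) (bernPi N p)
        - N * ∫ z, hajekLin N p (μ N) z ^ 2 ∂ bernPi N p)
      (a := fun N : ℕ => _ / √N) (eventually_atTop.2 ⟨1, fun N hN =>
      abs_variance_sub_le h0 h1 hN (integral_hajekLin (μ N) h0 h1 hN) (hL N hN) (hρ N hN)⟩)
      (tendsto_const_div_sqrt_nat _)
    simpa using hvar.sub hz
  refine tendsto_integral_of_tendsto_charFun h0 h1
    (fun N z => √N * (tauHatHA N (μ N) z - amr N p (μ N))) VHA.toNNReal fun t => ?_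
  have hg : Tendsto (fun N : ℕ => Complex.exp
      ((-((N * ∫ z, hajekLin N p (μ N) z ^ 2 ∂ bernPi N p) * t ^ 2 / 2) : ℝ))) atTop
      (𝓝 (Complex.exp ((-(VHA.toNNReal * t ^ 2 / 2) : ℝ)))) := by
    rw [Real.coe_toNNReal _ hV.le]
    have hc : Continuous fun x : ℝ => Complex.exp ((-(x * t ^ 2 / 2) : ℝ)) := by fun_prop
    exact (hc.tendsto VHA).comp hvarL
  have hA := squeeze_zero_norm' (a := fun N : ℕ => _ / √N) (eventually_atTop.2 ⟨1, fun N hN =>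
    norm_charFun_sub_charFun_le h0 h1 hN (hρ N hN) t⟩) (tendsto_const_div_sqrt_nat _)
  have hB := squeeze_zero_norm' (a := fun N : ℕ => _ / √N) (eventually_atTop.2 ⟨1, fun N hN =>
    norm_charFun_hajekLin_sub_le hd hdp hdp' hb.le hN (hrefl N) (hsymm N) (hScard N) (hbound N)
      (hSdep N) t⟩) (tendsto_const_div_sqrt_nat _)
  simpa using (hA.add hB).add hg
end
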